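/- arXiv:2210.01496 — 4 statements merged into one kernel-verified Lean document; each statement's English description precedes it below -/
import Mathlib

section
/- Let d ≥ 1 and let f : ℝ^d → ℝ be twice continuously differentiable and ρ-Hessian Lipschitz. Then for every smoothing parameter μ > 0 and all x, v ∈ ℝ^d, the zeroth-order Hessian-vector product estimator satisfies ‖𝓗_f(x)v − ∇²f(x)v‖ ≤ ρ·(‖v‖²/2 + √d·μ²/3). -/
open MeasureTheory

/-- The zeroth-order Hessian-vector product estimator
`𝓗_f(x)v = Σ_i ((f(x+v+μeᵢ) − f(x+v−μeᵢ) + f(x−μeᵢ) − f(x+μeᵢ))/(2μ)) eᵢ`. -/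
noncomputable def zoHvp (d : ℕ) (f : EuclideanSpace ℝ (Fin d) → ℝ) (μ : ℝ)
    (x v : EuclideanSpace ℝ (Fin d)) : EuclideanSpace ℝ (Fin d) :=
  ∑ i : Fin d,
    ((f (x + v + μ • EuclideanSpace.single i 1) - f (x + v - μ • EuclideanSpace.single i 1)
        + f (x - μ • EuclideanSpace.single i 1) - f (x + μ • EuclideanSpace.single i 1)) / (2 * μ))
      • EuclideanSpace.single i 1

theorem ContDiff.contDiff_gradient {E : Type*} [NormedAddCommGroup E] [InnerProductSpace ℝ E]
    [CompleteSpace E] {f : E → ℝ} {m n : WithTop ℕ∞} (hf : ContDiff ℝ n f) (hmn : m + 1 ≤ n) :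
    ContDiff ℝ m (gradient f) :=
  (InnerProductSpace.toDual ℝ E).symm.toContinuousLinearEquiv.contDiff.comp
    (hf.fderiv_right hmn)

/-- First-order Taylor bound for a map with Lipschitz derivative. -/
theorem norm_sub_sub_fderiv_le_of_lipschitz {E F : Type*} [NormedAddCommGroup E] [NormedSpace ℝ E]
    [NormedAddCommGroup F] [NormedSpace ℝ F] {G : E → F} (hG : Differentiable ℝ G) {ρ : ℝ}
    (hLip : ∀ x y, ‖fderiv ℝ G x - fderiv ℝ G y‖ ≤ ρ * ‖x - y‖) (x v : E) :
    ‖G (x + v) - G x - fderiv ℝ G x v‖ ≤ ρ * ‖v‖ ^ 2 / 2 := by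
  have hderiv (t : ℝ) : HasDerivAt (fun t : ℝ => G (x + t • v) - G x - t • fderiv ℝ G x v)
      (fderiv ℝ G (x + t • v) v - fderiv ℝ G x v) t := by
    have hline : HasDerivAt (fun t : ℝ => x + t • v) v t := by
      simpa using ((hasDerivAt_id t).smul_const v).const_add x
    have hlin : HasDerivAt (fun t : ℝ => t • fderiv ℝ G x v) (fderiv ℝ G x v) t := by
      simpa using (hasDerivAt_id t).smul_const (fderiv ℝ G x v)
    exact (((hG _).hasFDerivAt.comp_hasDerivAt t hline).sub_const _).sub hlin
  have hbound (t : ℝ) : HasDerivAt (fun t : ℝ => ρ * ‖v‖ ^ 2 * t ^ 2 / 2) (ρ * ‖v‖ ^ 2 * t) t := by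
    refine (((hasDerivAt_pow 2 t).const_mul (ρ * ‖v‖ ^ 2)).div_const 2).congr_deriv ?_
    push_cast
    ring
  have key := image_norm_le_of_norm_deriv_right_le_deriv_boundary (a := 0) (b := 1)
    (fun t _ => (hderiv t).continuousAt.continuousWithinAt)
    (fun t _ => (hderiv t).hasDerivWithinAt) (by simp) hbound
    (fun t ht => by
      calc ‖fderiv ℝ G (x + t • v) v - fderiv ℝ G x v‖
          ≤ ‖fderiv ℝ G (x + t • v) - fderiv ℝ G x‖ * ‖v‖ :=
            (fderiv ℝ G (x + t • v) - fderiv ℝ G x).le_opNorm v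
        _ ≤ ρ * ‖x + t • v - x‖ * ‖v‖ := by gcongr; exact hLip _ _
        _ = ρ * ‖v‖ ^ 2 * t := by
            rw [add_sub_cancel_left, norm_smul, Real.norm_of_nonneg ht.1]; ring)
    (Set.right_mem_Icc.2 zero_le_one)
  simpa using key

/-- Error of the central difference quotient for a function with Lipschitz Hessian. -/
theorem abs_central_difference_sub_inner_gradient_le {E : Type*} [NormedAddCommGroup E]
    [InnerProductSpace ℝ E] [CompleteSpace E] {f : E → ℝ} (hf : ContDiff ℝ 2 f) {ρ : ℝ}
    (hLip : ∀ x y, ‖fderiv ℝ (gradient f) x - fderiv ℝ (gradient f) y‖ ≤ ρ * ‖x - y‖)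
    {μ : ℝ} (hμ : 0 < μ) (y e : E) :
    |(f (y + μ • e) - f (y - μ • e)) / (2 * μ) - inner ℝ (gradient f y) e|
      ≤ ρ * ‖e‖ ^ 3 * μ ^ 2 / 6 := by
  have hgrad : Differentiable ℝ (gradient f) :=
    (hf.contDiff_gradient (m := 1) (by norm_num)).differentiable one_ne_zero
  have hfd : Differentiable ℝ f := hf.differentiable two_ne_zero
  have hderiv (t : ℝ) : HasDerivAt
      (fun t : ℝ => f (y + t • e) - f (y - t • e) - t * (2 * inner ℝ (gradient f y) e))
      (inner ℝ (gradient f (y + t • e) + gradient f (y - t • e) - (2 : ℝ) • gradient f y) e) t := by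
    have hsmul : HasDerivAt (fun t : ℝ => t • e) e t := by
      simpa using (hasDerivAt_id t).smul_const e
    have h := (((hfd _).hasGradientAt.hasFDerivAt.comp_hasDerivAt t (hsmul.const_add y)).sub
      ((hfd _).hasGradientAt.hasFDerivAt.comp_hasDerivAt t (hsmul.const_sub y))).sub
      ((hasDerivAt_id t).mul_const (2 * inner ℝ (gradient f y) e))
    refine h.congr_deriv ?_
    simp [inner_sub_left, inner_add_left, inner_smul_left]
  have hbound (t : ℝ) :
      HasDerivAt (fun t : ℝ => ρ * ‖e‖ ^ 3 * t ^ 3 / 3) (ρ * ‖e‖ ^ 3 * t ^ 2) t := by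
    refine (((hasDerivAt_pow 3 t).const_mul (ρ * ‖e‖ ^ 3)).div_const 3).congr_deriv ?_
    push_cast
    ring
  have hsecond (t : ℝ) :
      ‖gradient f (y + t • e) + gradient f (y - t • e) - (2 : ℝ) • gradient f y‖
        ≤ ρ * (t ^ 2 * ‖e‖ ^ 2) := by
    have hplus := norm_sub_sub_fderiv_le_of_lipschitz hgrad hLip y (t • e)
    have hminus := norm_sub_sub_fderiv_le_of_lipschitz hgrad hLip y (-(t • e))
    rw [norm_neg, ← sub_eq_add_neg, map_neg] at hminus
    have hnorm : ‖t • e‖ ^ 2 = t ^ 2 * ‖e‖ ^ 2 := by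
      rw [norm_smul, mul_pow, Real.norm_eq_abs, sq_abs]
    rw [hnorm] at hplus hminus
    refine (le_of_eq ?_).trans ((norm_add_le_of_le hplus hminus).trans_eq (by ring))
    congr 1
    module
  have key := image_norm_le_of_norm_deriv_right_le_deriv_boundary (a := 0) (b := μ)
    (fun t _ => (hderiv t).continuousAt.continuousWithinAt)
    (fun t _ => (hderiv t).hasDerivWithinAt) (by simp) hbound
    (fun t _ => by
      refine (norm_inner_le_norm _ _).trans ?_
      calc _ ≤ ρ * (t ^ 2 * ‖e‖ ^ 2) * ‖e‖ := by gcongr; exact hsecond t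
        _ = ρ * ‖e‖ ^ 3 * t ^ 2 := by ring)
    (Set.right_mem_Icc.2 hμ.le)
  have hquot : (f (y + μ • e) - f (y - μ • e)) / (2 * μ) - inner ℝ (gradient f y) e
      = (f (y + μ • e) - f (y - μ • e) - μ * (2 * inner ℝ (gradient f y) e)) / (2 * μ) := by
    field_simp
  rw [hquot, abs_div, abs_of_pos (by positivity : 0 < 2 * μ), div_le_iff₀ (by positivity)]
  exact key.trans_eq (by ring)

theorem EuclideanSpace.norm_le_sqrt_card_mul {ι : Type*} [Fintype ι] {w : EuclideanSpace ℝ ι}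
    {c : ℝ} (hc : 0 ≤ c) (hw : ∀ i, |w i| ≤ c) : ‖w‖ ≤ Real.sqrt (Fintype.card ι) * c := by
  rw [EuclideanSpace.norm_eq, ← Real.sqrt_sq hc, ← Real.sqrt_mul (Nat.cast_nonneg _)]
  refine Real.sqrt_le_sqrt ((Finset.sum_le_card_nsmul _ _ (c ^ 2) fun i _ => ?_).trans_eq ?_)
  · rw [Real.norm_eq_abs]
    gcongr
    exact hw i
  · simp

theorem zoHvp_apply (d : ℕ) (f : EuclideanSpace ℝ (Fin d) → ℝ) (μ : ℝ)
    (x v : EuclideanSpace ℝ (Fin d)) (i : Fin d) :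
    zoHvp d f μ x v i =
      (f (x + v + μ • EuclideanSpace.single i 1) - f (x + v - μ • EuclideanSpace.single i 1)
        + f (x - μ • EuclideanSpace.single i 1) - f (x + μ • EuclideanSpace.single i 1))
        / (2 * μ) := by
  simp [zoHvp, Pi.single_apply]

/-- If `f : ℝ^d → ℝ` (`d ≥ 1`) is twice continuously differentiable and `ρ`-Hessian Lipschitz,
then for every smoothing parameter `μ > 0` and all `x, v`,
`‖𝓗_f(x)v − ∇²f(x)v‖ ≤ ρ (‖v‖²/2 + √d μ²/3)`. -/
theorem zoHvp_error_bound (d : ℕ) (hd : 1 ≤ d) (f : EuclideanSpace ℝ (Fin d) → ℝ) (ρ : ℝ)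
    (hf : ContDiff ℝ 2 f)
    (hHessLip : ∀ x y : EuclideanSpace ℝ (Fin d),
      ‖fderiv ℝ (gradient f) x - fderiv ℝ (gradient f) y‖ ≤ ρ * ‖x - y‖)
    (μ : ℝ) (hμ : 0 < μ) (x v : EuclideanSpace ℝ (Fin d)) :
    ‖zoHvp d f μ x v - fderiv ℝ (gradient f) x v‖
      ≤ ρ * (‖v‖ ^ 2 / 2 + Real.sqrt d * μ ^ 2 / 3) := by
  have hcoord (i : Fin d) :
      |(zoHvp d f μ x v - (gradient f (x + v) - gradient f x)) i| ≤ ρ * μ ^ 2 / 3 := by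
    have hshift := abs_central_difference_sub_inner_gradient_le hf hHessLip hμ (x + v)
      (EuclideanSpace.single i 1)
    have hbase := abs_central_difference_sub_inner_gradient_le hf hHessLip hμ x
      (EuclideanSpace.single i 1)
    simp only [EuclideanSpace.inner_single_right, PiLp.norm_single, norm_one, one_pow,
      mul_one, one_mul, conj_trivial] at hshift hbase
    rw [PiLp.sub_apply, PiLp.sub_apply, zoHvp_apply]
    refine (le_of_eq ?_).trans ((abs_sub _ _).trans ((add_le_add hshift hbase).trans_eq (by ring)))
    congr 1
    ring
  have hsmoothing := EuclideanSpace.norm_le_sqrt_card_mul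
    ((abs_nonneg _).trans (hcoord ⟨0, hd⟩)) hcoord
  rw [Fintype.card_fin] at hsmoothing
  have htaylor := norm_sub_sub_fderiv_le_of_lipschitz
    ((hf.contDiff_gradient (m := 1) (by norm_num)).differentiable one_ne_zero) hHessLip x v
  calc ‖zoHvp d f μ x v - fderiv ℝ (gradient f) x v‖
      = ‖(zoHvp d f μ x v - (gradient f (x + v) - gradient f x))
          + (gradient f (x + v) - gradient f x - fderiv ℝ (gradient f) x v)‖ := by
        rw [sub_add_sub_cancel]
    _ ≤ Real.sqrt d * (ρ * μ ^ 2 / 3) + ρ * ‖v‖ ^ 2 / 2 := norm_add_le_of_le hsmoothing htaylor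
    _ = ρ * (‖v‖ ^ 2 / 2 + Real.sqrt d * μ ^ 2 / 3) := by ring
end

section
/- Let d ≥ 1 and let f : ℝ^d → ℝ be ℓ-smooth, twice continuously differentiable and ρ-Hessian Lipschitz. For μ > 0 let ∇̂_rand f(x) = d·((f(x+μu) − f(x−μu))/(2μ))·u, where the same direction u, uniform on the unit sphere S^{d−1} ⊂ ℝ^d, is used at both points. Then for all x, y ∈ ℝ^d, E_u[‖∇̂_rand f(x) − ∇̂_rand f(y)‖²] ≤ 2 d ℓ² ‖x−y‖² + ρ² d² μ⁴/18. -/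
open MeasureTheory

/-- The central-difference random gradient estimator
`∇̂_rand f(x) = d·((f(x+μu) − f(x−μu))/(2μ))·u`. -/
noncomputable def randGrad (d : ℕ) (f : EuclideanSpace ℝ (Fin d) → ℝ) (μ : ℝ)
    (x u : EuclideanSpace ℝ (Fin d)) : EuclideanSpace ℝ (Fin d) :=
  ((d : ℝ) * ((f (x + μ • u) - f (x - μ • u)) / (2 * μ))) • u

/-- The uniform probability measure on the unit sphere of `ℝ^d`, obtained by normalizing the
surface measure `volume.toSphere` and pushing it forward to `ℝ^d`. -/
noncomputable def sphereUniform (d : ℕ) : Measure (EuclideanSpace ℝ (Fin d)) :=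
  ((volume : Measure (EuclideanSpace ℝ (Fin d))).toSphere Set.univ)⁻¹ •
    Measure.map Subtype.val (volume : Measure (EuclideanSpace ℝ (Fin d))).toSphere

/-- **Wirtinger's inequality** for a `2π`-periodic `C¹` function, with its mean. -/
theorem integral_sq_le_integral_deriv_sq_add_mean {k k' : ℝ → ℝ}
    (hk : ∀ t, HasDerivAt k (k' t) t) (hk' : Continuous k') (hper : k (2 * Real.pi) = k 0) :
    (∫ t in 0..2 * Real.pi, k t ^ 2)
      ≤ (∫ t in 0..2 * Real.pi, k' t ^ 2) + (2 * Real.pi)⁻¹ * (∫ t in 0..2 * Real.pi, k t) ^ 2 := by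
  have hpi := Real.pi_pos
  have hab : (0 : ℝ) < 2 * Real.pi := by positivity
  have hkc : Continuous k := continuous_iff_continuousAt.2 fun t => (hk t).continuousAt
  have memL2 : ∀ g : ℝ → ℝ, Continuous g →
      MemLp (fun t => (g t : ℂ)) 2 (volume.restrict (Set.Ioc 0 (2 * Real.pi))) := fun g hg =>
    (memLp_two_iff_integrable_sq_norm (Complex.continuous_ofReal.comp hg).aestronglyMeasurable).2
      (((Complex.continuous_ofReal.comp hg).norm.pow 2).integrableOn_Ioc)
  have h1 := hasSum_sq_fourierCoeffOn hab (memL2 k hkc)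
  have h2 := hasSum_sq_fourierCoeffOn hab (memL2 k' hk')
  have h0 : ‖fourierCoeffOn hab (fun t => (k t : ℂ)) 0‖ ^ 2
      = ((2 * Real.pi)⁻¹ * ∫ t in 0..2 * Real.pi, k t) ^ 2 := by
    rw [fourierCoeffOn_eq_integral]
    simp only [neg_zero, fourier_zero, one_smul, sub_zero]
    rw [intervalIntegral.integral_ofReal, norm_smul, Complex.norm_real, one_div, mul_pow, mul_pow,
      Real.norm_eq_abs, Real.norm_eq_abs, sq_abs, sq_abs]
  have h3 := h2.add (hasSum_ite_eq (0 : ℤ) (((2 * Real.pi)⁻¹ * ∫ t in 0..2 * Real.pi, k t) ^ 2))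
  have hle := hasSum_le (fun n => ?_) h1 h3
  · simp only [Complex.norm_real, Real.norm_eq_abs, sq_abs, smul_eq_mul, sub_zero] at hle
    have := mul_le_mul_of_nonneg_left hle hab.le
    calc _ = 2 * Real.pi * ((2 * Real.pi)⁻¹ * ∫ t in 0..2 * Real.pi, k t ^ 2) := by field_simp
      _ ≤ _ := this
      _ = _ := by field_simp
  · by_cases hn : n = 0
    · subst hn
      simp only [if_true, h0]
      have : 0 ≤ ‖fourierCoeffOn hab (fun t => (k' t : ℂ)) 0‖ ^ 2 := by positivity
      linarith
    · have hc := fourierCoeffOn_of_hasDerivAt hab hn (f := fun t => (k t : ℂ))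
        (f' := fun t => (k' t : ℂ)) (fun t _ => (hk t).ofReal_comp)
        ((Complex.continuous_ofReal.comp hk').intervalIntegrable _ _)
      rw [hper, sub_self, mul_zero, zero_sub] at hc
      have hn1 : (1 : ℝ) ≤ |(n : ℝ)| := by
        exact_mod_cast Int.one_le_abs hn
      have : ‖fourierCoeffOn hab (fun t => (k t : ℂ)) n‖
          = ‖fourierCoeffOn hab (fun t => (k' t : ℂ)) n‖ / |(n : ℝ)| := by
        rw [hc]
        simp [abs_of_pos hpi]
        field_simp
      simp only [hn, if_false, add_zero]
      rw [this]
      gcongr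
      exact div_le_self (norm_nonneg _) hn1

section Projections

variable {V : Type*} [AddCommGroup V] [Module ℝ V] {P : ℕ → Module.End ℝ V} {N : V → ℝ}

theorem energy_sub_listProd_le_sum (hN : ∀ v, 0 ≤ N v)
    (hpyth : ∀ i v, N v = N (P i v) + N (v - P i v)) (hcomm : ∀ i j, Commute (P i) (P j))
    (n : ℕ) (v : V) :
    N v - N (((List.range n).map P).prod v) ≤ ∑ i ∈ Finset.range n, (N v - N (P i v)) := by
  induction n generalizing v with
  | zero => simp
  | succ n ih =>
    rw [List.range_succ, List.map_append, List.prod_append, Finset.sum_range_succ]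
    simp only [List.map_cons, List.map_nil, List.prod_cons, List.prod_nil, mul_one,
      Module.End.mul_apply]
    have hstep : ∑ i ∈ Finset.range n, (N (P n v) - N (P i (P n v)))
        ≤ ∑ i ∈ Finset.range n, (N v - N (P i v)) := by
      refine Finset.sum_le_sum fun i _ => ?_
      have hc : P n (P i v) = P i (P n v) := congrArg (· v) (hcomm n i)
      have h1 := hpyth n v
      have h2 := hpyth n (P i v)
      have h3 := hpyth i (v - P n v)
      rw [hc, ← map_sub] at h2
      have h4 := hN (v - P n v - P i (v - P n v))
      linarith
    linarith [ih (P n v)]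

/-- For commuting projections that split the energy `N`, the energy lost under pairs of projections
controls the energy lost under the product of all of them. -/
theorem pred_mul_energy_sub_listProd_le_sum (hN : ∀ v, 0 ≤ N v)
    (hpyth : ∀ i v, N v = N (P i v) + N (v - P i v)) (hcomm : ∀ i j, Commute (P i) (P j))
    (n : ℕ) (v : V) :
    ((n : ℝ) - 1) * (N v - N (((List.range n).map P).prod v))
      ≤ ∑ j ∈ Finset.range n, ∑ i ∈ Finset.range j, (N v - N (P i (P j v))) := by
  induction n generalizing v with
  | zero => simp
  | succ n ih =>
    have hA := energy_sub_listProd_le_sum hN hpyth hcomm n (P n v)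
    have hB := ih (P n v)
    rw [List.range_succ, List.map_append, List.prod_append, Finset.sum_range_succ]
    simp only [List.map_cons, List.map_nil, List.prod_cons, List.prod_nil, mul_one,
      Module.End.mul_apply]
    have hmono : ∀ i w, N (P i w) ≤ N w := fun i w => by linarith [hpyth i w, hN (w - P i w)]
    have hQ : ∑ j ∈ Finset.range n, ∑ i ∈ Finset.range j, (N (P n v) - N (P i (P j (P n v))))
        ≤ ∑ j ∈ Finset.range n, ∑ i ∈ Finset.range j, (N v - N (P i (P j v))) := by
      refine Finset.sum_le_sum fun j _ => Finset.sum_le_sum fun i _ => ?_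
      have hc : P n (P i (P j v)) = P i (P j (P n v)) := by
        have e1 : P n (P i (P j v)) = P i (P n (P j v)) := congrArg (· (P j v)) (hcomm n i)
        have e2 : P n (P j v) = P j (P n v) := congrArg (· v) (hcomm n j)
        rw [e1, e2]
      have h1 := hpyth n v
      have h2 := hpyth n (P i (P j v))
      rw [hc, ← map_sub, ← map_sub] at h2
      linarith [hmono i (P j (v - P n v)), hmono j (v - P n v)]
    have hlast : ∑ i ∈ Finset.range n, (N v - N (P i (P n v)))
        = n * (N v - N (P n v)) + ∑ i ∈ Finset.range n, (N (P n v) - N (P i (P n v))) := by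
      simp only [Finset.sum_sub_distrib, Finset.sum_const, Finset.card_range, nsmul_eq_mul]
      ring
    push_cast
    rw [hlast]
    linarith

end Projections

/-- A summed form of Lagrange's identity. -/
theorem sum_sum_range_sq_sub (a b : ℕ → ℝ) (n : ℕ) :
    ∑ j ∈ Finset.range n, ∑ i ∈ Finset.range j, (a j * b i - a i * b j) ^ 2
      = (∑ i ∈ Finset.range n, a i ^ 2) * (∑ i ∈ Finset.range n, b i ^ 2)
        - (∑ i ∈ Finset.range n, a i * b i) ^ 2 := by
  induction n with
  | zero => simp
  | succ n ih =>
    have : ∑ i ∈ Finset.range n, (a n * b i - a i * b n) ^ 2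
        = a n ^ 2 * ∑ i ∈ Finset.range n, b i ^ 2 + b n ^ 2 * ∑ i ∈ Finset.range n, a i ^ 2
          - 2 * a n * b n * ∑ i ∈ Finset.range n, a i * b i := by
      simp only [Finset.mul_sum, ← Finset.sum_add_distrib, ← Finset.sum_sub_distrib]
      exact Finset.sum_congr rfl fun i _ => by ring
    rw [Finset.sum_range_succ, ih, this]
    simp only [Finset.sum_range_succ]
    ring

section PlaneRotation

variable {E : Type*} [NormedAddCommGroup E] [InnerProductSpace ℝ E]

/-- The reflection `u ↦ u - 2 ⟪v, u⟫ v` (for a unit vector `v`). -/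
noncomputable def vectorFlip (v u : E) : E := u - (2 * inner ℝ v u) • v

/-- The rotation by the angle `θ` in the plane spanned by the orthonormal pair `v`, `w`. -/
noncomputable def planeRotation (v w : E) (θ : ℝ) : E →ₗ[ℝ] E :=
  LinearMap.id
    + ((Real.cos θ - 1) • (innerₛₗ ℝ v) - Real.sin θ • (innerₛₗ ℝ w)).smulRight v
    + ((Real.cos θ - 1) • (innerₛₗ ℝ w) + Real.sin θ • (innerₛₗ ℝ v)).smulRight w

theorem planeRotation_apply (v w u : E) (θ : ℝ) :
    planeRotation v w θ u
      = u + ((Real.cos θ - 1) * inner ℝ v u - Real.sin θ * inner ℝ w u) • v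
        + ((Real.cos θ - 1) * inner ℝ w u + Real.sin θ * inner ℝ v u) • w := by
  simp [planeRotation]

variable {v w : E}

theorem norm_planeRotation_apply (hv : ‖v‖ = 1) (hw : ‖w‖ = 1) (hvw : inner ℝ v w = 0)
    (θ : ℝ) (u : E) : ‖planeRotation v w θ u‖ = ‖u‖ := by
  have hv' : inner ℝ v v = (1 : ℝ) := by simp [hv]
  have hw' : inner ℝ w w = (1 : ℝ) := by simp [hw]
  have hwv : inner ℝ w v = (0 : ℝ) := by rw [real_inner_comm]; exact hvw
  have hsq : ‖planeRotation v w θ u‖ ^ 2 = ‖u‖ ^ 2 := by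
    rw [← real_inner_self_eq_norm_sq, ← real_inner_self_eq_norm_sq, planeRotation_apply]
    simp only [inner_add_left, inner_add_right, real_inner_smul_left, real_inner_smul_right, hv',
      hw', hvw, hwv, real_inner_comm v u, real_inner_comm w u]
    linear_combination (inner ℝ v u ^ 2 + inner ℝ w u ^ 2) * Real.sin_sq_add_cos_sq θ
  exact (sq_eq_sq₀ (norm_nonneg _) (norm_nonneg _)).1 hsq

theorem hasDerivAt_planeRotation (hv : ‖v‖ = 1) (hw : ‖w‖ = 1) (hvw : inner ℝ v w = 0)
    (θ : ℝ) (u : E) :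
    HasDerivAt (fun t => planeRotation v w t u)
      (inner ℝ v (planeRotation v w θ u) • w - inner ℝ w (planeRotation v w θ u) • v) θ := by
  have hv' : inner ℝ v v = (1 : ℝ) := by simp [hv]
  have hw' : inner ℝ w w = (1 : ℝ) := by simp [hw]
  have hwv : inner ℝ w v = (0 : ℝ) := by rw [real_inner_comm]; exact hvw
  simp only [planeRotation_apply]
  have hc := Real.hasDerivAt_cos θ
  have hs := Real.hasDerivAt_sin θ
  have h := (((((hc.sub_const 1).mul_const (inner ℝ v u)).sub (hs.mul_const (inner ℝ w u))).smul_const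
    v).const_add u).add ((((hc.sub_const 1).mul_const (inner ℝ w u)).add
      (hs.mul_const (inner ℝ v u))).smul_const w)
  refine h.congr_deriv ?_
  simp only [inner_add_right, real_inner_smul_right, hv', hw', hvw, hwv]
  module

theorem continuous_planeRotation (v w : E) :
    Continuous fun p : ℝ × E => planeRotation v w p.1 p.2 := by
  simp only [planeRotation_apply]
  fun_prop

theorem continuous_planeRotation_angle (v w u : E) :
    Continuous fun t => planeRotation v w t u := by
  simp only [planeRotation_apply]
  fun_prop

theorem exists_rotation_angle (a b : ℝ) :
    ∃ φ, a * Real.cos φ - b * Real.sin φ = -a ∧ a * Real.sin φ + b * Real.cos φ = b := by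
  set z : ℂ := ⟨a, b⟩
  have ha : a = ‖z‖ * Real.cos z.arg := (Complex.norm_mul_cos_arg z).symm
  have hb : b = ‖z‖ * Real.sin z.arg := (Complex.norm_mul_sin_arg z).symm
  refine ⟨Real.pi - 2 * z.arg, ?_, ?_⟩
  · rw [Real.cos_pi_sub, Real.sin_pi_sub, Real.cos_two_mul', Real.sin_two_mul, ha, hb]
    linear_combination -‖z‖ * Real.cos z.arg * Real.sin_sq_add_cos_sq z.arg
  · rw [Real.cos_pi_sub, Real.sin_pi_sub, Real.cos_two_mul', Real.sin_two_mul, ha, hb]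
    linear_combination ‖z‖ * Real.sin z.arg * Real.sin_sq_add_cos_sq z.arg

theorem exists_vectorFlip_left_planeRotation (hv : ‖v‖ = 1) (hvw : inner ℝ v w = 0) (u : E) :
    ∃ φ, ∀ θ, vectorFlip v (planeRotation v w θ u) = planeRotation v w (φ - θ) u := by
  have hv' : inner ℝ v v = (1 : ℝ) := by simp [hv]
  obtain ⟨φ, h1, h2⟩ := exists_rotation_angle (inner ℝ v u) (inner ℝ w u)
  refine ⟨φ, fun θ => ?_⟩
  simp only [vectorFlip, planeRotation_apply, inner_add_right, real_inner_smul_right, hv', hvw,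
    Real.cos_sub, Real.sin_sub]
  match_scalars
  · ring
  · linear_combination -Real.cos θ * h1 - Real.sin θ * h2
  · linear_combination -Real.cos θ * h2 + Real.sin θ * h1

theorem exists_vectorFlip_right_planeRotation (hw : ‖w‖ = 1) (hvw : inner ℝ v w = 0) (u : E) :
    ∃ φ, ∀ θ, vectorFlip w (planeRotation v w θ u) = planeRotation v w (φ - θ) u := by
  have hw' : inner ℝ w w = (1 : ℝ) := by simp [hw]
  have hwv : inner ℝ w v = (0 : ℝ) := by rw [real_inner_comm]; exact hvw
  obtain ⟨φ, h1, h2⟩ := exists_rotation_angle (inner ℝ v u) (inner ℝ w u)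
  refine ⟨φ + Real.pi, fun θ => ?_⟩
  have e : φ + Real.pi - θ = (φ - θ) + Real.pi := by ring
  rw [e]
  simp only [vectorFlip, planeRotation_apply, inner_add_right, real_inner_smul_right, hw', hwv,
    Real.cos_add_pi, Real.sin_add_pi, Real.cos_sub, Real.sin_sub]
  match_scalars
  · ring
  · linear_combination Real.cos θ * h1 + Real.sin θ * h2
  · linear_combination Real.cos θ * h2 - Real.sin θ * h1

theorem norm_vectorFlip (hv : ‖v‖ = 1 ∨ v = 0) (u : E) : ‖vectorFlip v u‖ = ‖u‖ := by
  rcases hv with hv | rfl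
  · have hv' : inner ℝ v v = (1 : ℝ) := by simp [hv]
    have hsq : ‖vectorFlip v u‖ ^ 2 = ‖u‖ ^ 2 := by
      rw [← real_inner_self_eq_norm_sq, ← real_inner_self_eq_norm_sq, vectorFlip]
      simp only [inner_sub_left, inner_sub_right, real_inner_smul_left, real_inner_smul_right, hv',
        real_inner_comm v u]
      ring
    exact (sq_eq_sq₀ (norm_nonneg _) (norm_nonneg _)).1 hsq
  · simp [vectorFlip]

theorem vectorFlip_vectorFlip (hv : ‖v‖ = 1 ∨ v = 0) (u : E) :
    vectorFlip v (vectorFlip v u) = u := by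
  rcases hv with hv | rfl
  · have hv' : inner ℝ v v = (1 : ℝ) := by simp [hv]
    simp only [vectorFlip, inner_sub_right, real_inner_smul_right, hv']
    module
  · simp [vectorFlip]

theorem vectorFlip_comm (hvw : inner ℝ v w = 0) (u : E) :
    vectorFlip v (vectorFlip w u) = vectorFlip w (vectorFlip v u) := by
  have hwv : inner ℝ w v = (0 : ℝ) := by rw [real_inner_comm]; exact hvw
  simp only [vectorFlip, inner_sub_right, real_inner_smul_right, hvw, hwv]
  module

@[fun_prop]
theorem continuous_vectorFlip (v : E) : Continuous (vectorFlip v) := by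
  unfold vectorFlip
  fun_prop

theorem vectorFlip_neg (v u : E) : vectorFlip v (-u) = -vectorFlip v u := by
  simp only [vectorFlip, inner_neg_right]
  module

/-- The reflection `vectorFlip v` as a linear isometry. -/
noncomputable def vectorFlipIsometry (v : E) (hv : ‖v‖ = 1 ∨ v = 0) : E →ₗᵢ[ℝ] E where
  toLinearMap := LinearMap.id - (2 : ℝ) • (innerₛₗ ℝ v).smulRight v
  norm_map' u := by
    rw [← norm_vectorFlip hv u]
    congr 1
    simp [vectorFlip, mul_smul]

theorem vectorFlipIsometry_apply (hv : ‖v‖ = 1 ∨ v = 0) (u : E) :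
    vectorFlipIsometry v hv u = vectorFlip v u := by
  change u - (2 : ℝ) • (inner ℝ v u • v) = _
  rw [vectorFlip, mul_smul]

/-- Averaging over the group generated by the reflection `vectorFlip v`. -/
noncomputable def flipAverage (v : E) : Module.End ℝ C(E, ℝ) :=
  (2⁻¹ : ℝ) • (1 + (ContinuousMap.compRightAlgHom ℝ ℝ
    (⟨vectorFlip v, continuous_vectorFlip v⟩ : C(E, E))).toLinearMap)

theorem flipAverage_apply (v : E) (h : C(E, ℝ)) (u : E) :
    flipAverage v h u = 2⁻¹ * (h u + h (vectorFlip v u)) := rfl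

end PlaneRotation

section SphereMeasure

variable {E : Type*} [NormedAddCommGroup E] [InnerProductSpace ℝ E] [MeasurableSpace E]

/-- A measure concentrated on the unit sphere and invariant under linear isometries. -/
structure IsInvariantOnUnitSphere (σ : Measure E) : Prop where
  ae_norm_eq_one : ∀ᵐ u ∂σ, ‖u‖ = 1
  measurePreserving : ∀ A : E →ₗᵢ[ℝ] E, MeasurePreserving A σ σ

namespace IsInvariantOnUnitSphere

variable {σ : Measure E}

theorem restrict_sphere (hσ : IsInvariantOnUnitSphere σ) :
    σ.restrict (Metric.sphere 0 1) = σ :=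
  Measure.restrict_eq_self_of_ae_mem (by simpa using hσ.ae_norm_eq_one)

variable [BorelSpace E]

theorem integral_comp (hσ : IsInvariantOnUnitSphere σ) (A : E →ₗᵢ[ℝ] E) {g : E → ℝ}
    (hg : Continuous g) : ∫ u, g (A u) ∂σ = ∫ u, g u ∂σ := by
  have h := hσ.measurePreserving A
  conv_rhs => rw [← h.map_eq]
  rw [integral_map h.measurable.aemeasurable hg.aestronglyMeasurable]

variable [FiniteDimensional ℝ E] [IsFiniteMeasure σ]

theorem integrable (hσ : IsInvariantOnUnitSphere σ) {g : E → ℝ} (hg : Continuous g) :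
    Integrable g σ := by
  rw [← hσ.restrict_sphere]
  exact hg.continuousOn.integrableOn_compact (isCompact_sphere 0 1)

theorem integral_intervalIntegral_swap (hσ : IsInvariantOnUnitSphere σ) {G : ℝ × E → ℝ}
    (hG : Continuous G) (a b : ℝ) :
    ∫ t in a..b, ∫ u, G (t, u) ∂σ = ∫ u, (∫ t in a..b, G (t, u)) ∂σ := by
  refine intervalIntegral_integral_swap (f := fun t u => G (t, u)) ?_
  rw [← hσ.restrict_sphere, Measure.prod_restrict]
  have h : IntegrableOn G (Set.uIcc a b ×ˢ Metric.sphere 0 1) (volume.prod σ) :=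
    hG.continuousOn.integrableOn_compact (isCompact_uIcc.prod (isCompact_sphere 0 1))
  exact h.mono_set (Set.prod_mono Set.uIoc_subset_uIcc le_rfl)

theorem integral_circleIntegral_planeRotation (hσ : IsInvariantOnUnitSphere σ) {v w : E}
    (hv : ‖v‖ = 1) (hw : ‖w‖ = 1) (hvw : inner ℝ v w = 0) {g : E → ℝ} (hg : Continuous g) :
    ∫ u, (∫ t in 0..2 * Real.pi, g (planeRotation v w t u)) ∂σ = 2 * Real.pi * ∫ u, g u ∂σ := by
  rw [← hσ.integral_intervalIntegral_swap (G := fun p => g (planeRotation v w p.1 p.2))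
    (hg.comp (continuous_planeRotation v w))]
  have : ∀ t, ∫ u, g (planeRotation v w t u) ∂σ = ∫ u, g u ∂σ := fun t =>
    hσ.integral_comp ⟨planeRotation v w t, norm_planeRotation_apply hv hw hvw t⟩ hg
  simp [this]

end IsInvariantOnUnitSphere

end SphereMeasure

section Poincare

variable {E : Type*} [NormedAddCommGroup E] [InnerProductSpace ℝ E]

theorem periodic_planeRotation (v w u : E) :
    Function.Periodic (fun t => planeRotation v w t u) (2 * Real.pi) := fun t => by
  simp only [planeRotation_apply, Real.cos_add_two_pi, Real.sin_add_two_pi]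

theorem circleIntegral_comp_planeRotation_of_reflect {v w u : E} {h₁ h₂ : E → ℝ} {φ : ℝ}
    (hφ : ∀ t, h₁ (planeRotation v w t u) = h₂ (planeRotation v w (φ - t) u)) :
    ∫ t in 0..2 * Real.pi, h₁ (planeRotation v w t u)
      = ∫ t in 0..2 * Real.pi, h₂ (planeRotation v w t u) := by
  have hp : Function.Periodic (fun t => h₂ (planeRotation v w t u)) (2 * Real.pi) :=
    (periodic_planeRotation v w u).comp h₂
  have h := hp.intervalIntegral_add_eq (φ - 2 * Real.pi) 0
  simp only [hφ]
  rw [intervalIntegral.integral_comp_sub_left (fun t => h₂ (planeRotation v w t u)), sub_zero]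
  simpa using h

theorem circleIntegral_flipAverage {v w u x : E}
    (hx : ∃ φ, ∀ t, vectorFlip x (planeRotation v w t u) = planeRotation v w (φ - t) u)
    (h : C(E, ℝ)) :
    ∫ t in 0..2 * Real.pi, flipAverage x h (planeRotation v w t u)
      = ∫ t in 0..2 * Real.pi, h (planeRotation v w t u) := by
  obtain ⟨φ, hφ⟩ := hx
  have hR : Continuous fun t => planeRotation v w t u :=
    continuous_planeRotation_angle v w u
  have h2 : ∫ t in 0..2 * Real.pi, h (vectorFlip x (planeRotation v w t u))
      = ∫ t in 0..2 * Real.pi, h (planeRotation v w t u) :=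
    circleIntegral_comp_planeRotation_of_reflect (h₁ := fun y => h (vectorFlip x y)) (h₂ := h)
      (φ := φ) fun t => by rw [hφ]
  simp only [flipAverage_apply]
  rw [intervalIntegral.integral_const_mul, intervalIntegral.integral_add, h2]
  · ring
  · exact (h.continuous.comp hR).intervalIntegrable _ _
  · exact (h.continuous.comp ((continuous_vectorFlip x).comp hR)).intervalIntegrable _ _

/-- The square of the mean over the circle is at most the mean of the square. -/
theorem sq_circleIntegral_le {g : ℝ → ℝ} (hg : Continuous g) :
    (2 * Real.pi)⁻¹ * (∫ t in 0..2 * Real.pi, g t) ^ 2 ≤ ∫ t in 0..2 * Real.pi, g t ^ 2 := by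
  have hpi := Real.pi_pos
  set m := (2 * Real.pi)⁻¹ * ∫ t in 0..2 * Real.pi, g t with hm
  have hint : ∫ t in 0..2 * Real.pi, g t = 2 * Real.pi * m := by rw [hm]; field_simp
  have h0 : 0 ≤ ∫ t in 0..2 * Real.pi, (g t - m) ^ 2 :=
    intervalIntegral.integral_nonneg (by positivity) fun t _ => sq_nonneg _
  have h1 : ∫ t in 0..2 * Real.pi, (g t - m) ^ 2
      = (∫ t in 0..2 * Real.pi, g t ^ 2) - 2 * Real.pi * m ^ 2 := by
    have : ∀ t, (g t - m) ^ 2 = g t ^ 2 - (2 * m * g t - m ^ 2) := fun t => by ring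
    simp only [this]
    rw [intervalIntegral.integral_sub, intervalIntegral.integral_sub,
      intervalIntegral.integral_const_mul, hint]
    · simp
      ring
    all_goals exact Continuous.intervalIntegrable (by fun_prop) _ _
  rw [hint]
  have : (2 * Real.pi)⁻¹ * (2 * Real.pi * m) ^ 2 = 2 * Real.pi * m ^ 2 := by field_simp
  linarith

/-- Wirtinger's inequality along the circle through `u` in the plane of `v`, `w`. -/
theorem circleIntegral_sq_le [CompleteSpace E] {v w : E} (hv : ‖v‖ = 1) (hw : ‖w‖ = 1)
    (hvw : inner ℝ v w = 0) (h : C(E, ℝ)) {G : E → E} (hgrad : ∀ u, HasGradientAt h (G u) u)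
    {D : E → ℝ} (hDc : Continuous D)
    (hD : ∀ u, D u = inner ℝ v u * inner ℝ w (G u) - inner ℝ w u * inner ℝ v (G u)) (u : E) :
    (∫ t in 0..2 * Real.pi, h (planeRotation v w t u) ^ 2)
      ≤ (∫ t in 0..2 * Real.pi, D (planeRotation v w t u) ^ 2)
        + ∫ t in 0..2 * Real.pi, flipAverage v (flipAverage w h) (planeRotation v w t u) ^ 2 := by
  have hR := continuous_planeRotation_angle v w u
  have hder : ∀ t, HasDerivAt (fun t => h (planeRotation v w t u))
      (D (planeRotation v w t u)) t := fun t => by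
    have h1 := (hgrad (planeRotation v w t u)).hasFDerivAt.comp_hasDerivAt t
      (hasDerivAt_planeRotation hv hw hvw t u)
    refine h1.congr_deriv ?_
    rw [hD, InnerProductSpace.toDual_apply_apply, inner_sub_right, real_inner_smul_right,
      real_inner_smul_right, real_inner_comm w, real_inner_comm v]
  have h1 := integral_sq_le_integral_deriv_sq_add_mean hder (hDc.comp hR)
    (by simpa using congrArg h (periodic_planeRotation v w u 0))
  have h2 := sq_circleIntegral_le (g := fun t => flipAverage v (flipAverage w h)
    (planeRotation v w t u)) ((map_continuous _).comp hR)
  rw [circleIntegral_flipAverage (exists_vectorFlip_left_planeRotation hv hvw u),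
    circleIntegral_flipAverage (exists_vectorFlip_right_planeRotation hw hvw u)] at h2
  linarith

theorem continuous_circleIntegral_planeRotation (v w : E) {q : E → ℝ} (hq : Continuous q) :
    Continuous fun u => ∫ t in 0..2 * Real.pi, q (planeRotation v w t u) := by
  have h : Continuous fun p : E × ℝ => q (planeRotation v w p.2 p.1) := by
    simp only [planeRotation_apply]
    fun_prop
  exact intervalIntegral.continuous_parametric_intervalIntegral_of_continuous' h _ _

variable [MeasurableSpace E] [BorelSpace E] [FiniteDimensional ℝ E] {σ : Measure E}

/-- Wirtinger's inequality along the circles in a fixed coordinate plane, averaged over an invariant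
measure. -/
theorem IsInvariantOnUnitSphere.integral_sq_sub_integral_flipAverage_sq_le [IsFiniteMeasure σ]
    (hσ : IsInvariantOnUnitSphere σ) {v w : E} (hv : ‖v‖ = 1) (hw : ‖w‖ = 1)
    (hvw : inner ℝ v w = 0) (h : C(E, ℝ)) {G : E → E} (hG : Continuous G)
    (hgrad : ∀ u, HasGradientAt h (G u) u) :
    (∫ u, h u ^ 2 ∂σ) - ∫ u, flipAverage v (flipAverage w h) u ^ 2 ∂σ
      ≤ ∫ u, (inner ℝ v u * inner ℝ w (G u) - inner ℝ w u * inner ℝ v (G u)) ^ 2 ∂σ := by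
  have hpi := Real.pi_pos
  have hDc : Continuous fun u =>
    (inner ℝ v u * inner ℝ w (G u) - inner ℝ w u * inner ℝ v (G u) : ℝ) := by fun_prop
  have hD2 : Continuous fun u =>
    ((inner ℝ v u * inner ℝ w (G u) - inner ℝ w u * inner ℝ v (G u)) ^ 2 : ℝ) := hDc.pow 2
  have hh2 : Continuous fun u => h u ^ 2 := by fun_prop
  have hg2 : Continuous fun u => flipAverage v (flipAverage w h) u ^ 2 := (map_continuous _).pow 2
  have hcont := fun {q : E → ℝ} (hq : Continuous q) =>
    hσ.integrable (continuous_circleIntegral_planeRotation v w hq)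
  have hmono := integral_mono (hcont hh2) ((hcont hD2).add (hcont hg2))
    (circleIntegral_sq_le hv hw hvw h hgrad hDc fun _ => rfl)
  rw [integral_add' (hcont hD2) (hcont hg2),
    hσ.integral_circleIntegral_planeRotation hv hw hvw hh2,
    hσ.integral_circleIntegral_planeRotation hv hw hvw hD2,
    hσ.integral_circleIntegral_planeRotation hv hw hvw hg2, ← mul_add] at hmono
  have := le_of_mul_le_mul_left hmono (by positivity)
  linarith

theorem IsInvariantOnUnitSphere.integral_sq_eq_flipAverage_add [IsFiniteMeasure σ]
    (hσ : IsInvariantOnUnitSphere σ) {v : E} (hv : ‖v‖ = 1 ∨ v = 0) (h : C(E, ℝ)) :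
    ∫ u, h u ^ 2 ∂σ
      = (∫ u, flipAverage v h u ^ 2 ∂σ) + ∫ u, (h - flipAverage v h) u ^ 2 ∂σ := by
  have hc : Continuous fun u => h u ^ 2 := by fun_prop
  have hc' : Continuous fun u => h (vectorFlip v u) ^ 2 := by fun_prop
  have hinv : ∫ u, h (vectorFlip v u) ^ 2 ∂σ = ∫ u, h u ^ 2 ∂σ := by
    simpa only [vectorFlipIsometry_apply] using hσ.integral_comp (vectorFlipIsometry v hv) hc
  rw [← integral_add (hσ.integrable (by fun_prop)) (hσ.integrable (by fun_prop))]
  have : ∀ u, flipAverage v h u ^ 2 + (h - flipAverage v h) u ^ 2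
      = 2⁻¹ * (h u ^ 2 + h (vectorFlip v u) ^ 2) := fun u => by
    simp only [ContinuousMap.sub_apply, flipAverage_apply]
    ring
  simp only [this]
  rw [integral_const_mul, integral_add (hσ.integrable hc) (hσ.integrable hc'), hinv]
  ring

end Poincare

section OddPoincare

variable {E : Type*} [NormedAddCommGroup E] [InnerProductSpace ℝ E]

theorem flipAverage_commute {v w : E} (hvw : inner ℝ v w = 0) :
    Commute (flipAverage v) (flipAverage w) := by
  refine LinearMap.ext fun h => ContinuousMap.ext fun u => ?_
  simp only [Module.End.mul_apply, flipAverage_apply, vectorFlip_comm hvw]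
  ring

variable {e : ℕ → E}

theorem listProd_flipAverage_neg {h : C(E, ℝ)} (hodd : ∀ u, h (-u) = -h u) (n : ℕ) (u : E) :
    ((List.range n).map fun i => flipAverage (e i)).prod h (-u)
      = -((List.range n).map fun i => flipAverage (e i)).prod h u := by
  induction n generalizing h with
  | zero => simpa using hodd u
  | succ n ih =>
    rw [List.range_succ, List.map_append, List.prod_append]
    simp only [List.map_cons, List.map_nil, List.prod_cons, List.prod_nil, mul_one,
      Module.End.mul_apply]
    refine ih fun u => ?_
    simp only [flipAverage_apply, vectorFlip_neg, hodd]
    ring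

theorem listProd_flipAverage_vectorFlip_of_invariant (horth : ∀ i j, i ≠ j → inner ℝ (e i) (e j) = 0)
    {k : ℕ} {h : C(E, ℝ)} (hk : ∀ u, h (vectorFlip (e k) u) = h u) (n : ℕ) (u : E) :
    ((List.range n).map fun i => flipAverage (e i)).prod h (vectorFlip (e k) u)
      = ((List.range n).map fun i => flipAverage (e i)).prod h u := by
  induction n generalizing h with
  | zero => simpa using hk u
  | succ n ih =>
    rw [List.range_succ, List.map_append, List.prod_append]
    simp only [List.map_cons, List.map_nil, List.prod_cons, List.prod_nil, mul_one,
      Module.End.mul_apply]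
    refine ih fun u => ?_
    simp only [flipAverage_apply, hk]
    rcases eq_or_ne n k with rfl | hnk
    · rw [hk (vectorFlip (e n) u), hk]
    · rw [vectorFlip_comm (horth n k hnk), hk]

theorem listProd_flipAverage_vectorFlip (horth : ∀ i j, i ≠ j → inner ℝ (e i) (e j) = 0)
    (hunit : ∀ i, ‖e i‖ = 1 ∨ e i = 0) {i n : ℕ} (hi : i < n) (h : C(E, ℝ)) (u : E) :
    ((List.range n).map fun i => flipAverage (e i)).prod h (vectorFlip (e i) u)
      = ((List.range n).map fun i => flipAverage (e i)).prod h u := by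
  induction n generalizing h with
  | zero => simp at hi
  | succ n ih =>
    rw [List.range_succ, List.map_append, List.prod_append]
    simp only [List.map_cons, List.map_nil, List.prod_cons, List.prod_nil, mul_one,
      Module.End.mul_apply]
    rcases Nat.lt_succ_iff_lt_or_eq.1 hi with hlt | rfl
    · exact ih hlt _
    · refine listProd_flipAverage_vectorFlip_of_invariant horth (fun u => ?_) _ _
      simp only [flipAverage_apply, vectorFlip_vectorFlip (hunit i)]
      ring

theorem listProd_flipAverage_eq_zero (horth : ∀ i j, i ≠ j → inner ℝ (e i) (e j) = 0)
    (hunit : ∀ i, ‖e i‖ = 1 ∨ e i = 0) {d : ℕ}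
    (hspan : ∀ u, ∑ i ∈ Finset.range d, inner ℝ (e i) u • e i = u)
    {h : C(E, ℝ)} (hodd : ∀ u, h (-u) = -h u) :
    ((List.range d).map fun i => flipAverage (e i)).prod h = 0 := by
  refine ContinuousMap.ext fun u => ?_
  set q := ((List.range d).map fun i => flipAverage (e i)).prod h with hq
  have hflip : ∀ n ≤ d, q (u - (2 : ℝ) • ∑ i ∈ Finset.range n, inner ℝ (e i) u • e i) = q u := by
    intro n hn
    induction n with
    | zero => simp
    | succ n ih =>
      rw [← ih (by omega), ← listProd_flipAverage_vectorFlip horth hunit (Nat.lt_of_succ_le hn) h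
        (u - (2 : ℝ) • ∑ i ∈ Finset.range n, inner ℝ (e i) u • e i), ← hq]
      congr 1
      have h0 : inner ℝ (e n) (∑ i ∈ Finset.range n, inner ℝ (e i) u • e i) = 0 := by
        rw [inner_sum]
        refine Finset.sum_eq_zero fun i hi => ?_
        rw [real_inner_smul_right, horth n i (Finset.mem_range.1 hi).ne', mul_zero]
      rw [vectorFlip, inner_sub_right, real_inner_smul_right, h0, Finset.sum_range_succ]
      module
  have h1 := hflip d le_rfl
  rw [hspan, show u - (2 : ℝ) • u = -u by module, hq, listProd_flipAverage_neg hodd, ← hq] at h1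
  have : q u = 0 := by linarith
  simpa using this

theorem sum_range_inner_sq {d : ℕ} (hspan : ∀ u, ∑ i ∈ Finset.range d, inner ℝ (e i) u • e i = u)
    (u : E) : ∑ i ∈ Finset.range d, inner ℝ (e i) u ^ 2 = ‖u‖ ^ 2 := by
  rw [← real_inner_self_eq_norm_sq]
  conv_rhs => rw [← hspan u, sum_inner]
  refine Finset.sum_congr rfl fun i _ => ?_
  rw [real_inner_smul_left, hspan, sq]

variable [MeasurableSpace E] [BorelSpace E] [FiniteDimensional ℝ E] {σ : Measure E}

/-- **Poincaré inequality** on the unit sphere for an odd function with bounded gradient. -/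
theorem IsInvariantOnUnitSphere.pred_mul_integral_sq_le [IsProbabilityMeasure σ]
    (hσ : IsInvariantOnUnitSphere σ) (horth : ∀ i j, i ≠ j → inner ℝ (e i) (e j) = 0) {d : ℕ}
    (hunit : ∀ i, i < d → ‖e i‖ = 1) (hzero : ∀ i, d ≤ i → e i = 0)
    (hspan : ∀ u, ∑ i ∈ Finset.range d, inner ℝ (e i) u • e i = u)
    {h : C(E, ℝ)} (hodd : ∀ u, h (-u) = -h u) {G : E → E} (hG : Continuous G)
    (hgrad : ∀ u, HasGradientAt h (G u) u) {L : ℝ} (hL : ∀ u, ‖G u‖ ≤ L) :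
    ((d : ℝ) - 1) * ∫ u, h u ^ 2 ∂σ ≤ L ^ 2 := by
  have hunit' : ∀ i, ‖e i‖ = 1 ∨ e i = 0 := fun i =>
    (lt_or_ge i d).imp (hunit i) (hzero i)
  have hproj := pred_mul_energy_sub_listProd_le_sum (P := fun i => flipAverage (e i))
    (N := fun g => ∫ u, g u ^ 2 ∂σ) (fun g => integral_nonneg fun u => sq_nonneg _)
    (fun i g => hσ.integral_sq_eq_flipAverage_add (hunit' i) g)
    (fun i j => by
      rcases eq_or_ne i j with rfl | hij
      · exact Commute.refl _
      · exact flipAverage_commute (horth i j hij)) d h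
  rw [listProd_flipAverage_eq_zero horth hunit' hspan hodd] at hproj
  simp only [ContinuousMap.zero_apply, ne_eq, OfNat.ofNat_ne_zero, not_false_eq_true, zero_pow,
    integral_zero, sub_zero] at hproj
  have hcont : ∀ i j, Continuous fun u =>
      (inner ℝ (e i) u * inner ℝ (e j) (G u) - inner ℝ (e j) u * inner ℝ (e i) (G u)) ^ 2 :=
    fun i j => by fun_prop
  refine hproj.trans ?_
  calc _ ≤ ∑ j ∈ Finset.range d, ∑ i ∈ Finset.range j, ∫ u,
        (inner ℝ (e i) u * inner ℝ (e j) (G u) - inner ℝ (e j) u * inner ℝ (e i) (G u)) ^ 2 ∂σ := by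
        refine Finset.sum_le_sum fun j hj => Finset.sum_le_sum fun i hi => ?_
        have hj' := Finset.mem_range.1 hj
        have hi' := Finset.mem_range.1 hi
        exact hσ.integral_sq_sub_integral_flipAverage_sq_le (hunit i (hi'.trans hj')) (hunit j hj')
          (horth i j hi'.ne) h hG hgrad
    _ = ∫ u, ∑ j ∈ Finset.range d, ∑ i ∈ Finset.range j,
        (inner ℝ (e i) u * inner ℝ (e j) (G u) - inner ℝ (e j) u * inner ℝ (e i) (G u)) ^ 2 ∂σ := by
        rw [integral_finsetSum _ fun j _ => integrable_finsetSum _ fun i _ =>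
          hσ.integrable (hcont i j)]
        refine Finset.sum_congr rfl fun j _ => ?_
        rw [integral_finsetSum _ fun i _ => hσ.integrable (hcont i j)]
    _ ≤ ∫ _, L ^ 2 ∂σ := by
        refine integral_mono_ae (integrable_finsetSum _ fun j _ => integrable_finsetSum _ fun i _ =>
          hσ.integrable (hcont i j)) (integrable_const _) ?_
        filter_upwards [hσ.ae_norm_eq_one] with u hu
        have hlag := sum_sum_range_sq_sub (fun i => inner ℝ (e i) (G u)) (fun i => inner ℝ (e i) u) d
        rw [sum_range_inner_sq hspan, sum_range_inner_sq hspan, hu] at hlag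
        have hGL : ‖G u‖ ^ 2 ≤ L ^ 2 := by gcongr; exact hL u
        have : ∀ i j, (inner ℝ (e i) u * inner ℝ (e j) (G u)
            - inner ℝ (e j) u * inner ℝ (e i) (G u)) ^ 2
            = (inner ℝ (e j) (G u) * inner ℝ (e i) u
              - inner ℝ (e i) (G u) * inner ℝ (e j) u) ^ 2 := fun i j => by ring
        simp only [this, hlag]
        nlinarith [sq_nonneg (∑ i ∈ Finset.range d, inner ℝ (e i) (G u) * inner ℝ (e i) u)]
    _ = L ^ 2 := by simp

end OddPoincare

theorem isProbabilityMeasure_sphereUniform {d : ℕ} (hd : 1 ≤ d) :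
    IsProbabilityMeasure (sphereUniform d) := by
  have : Nonempty (Fin d) := ⟨⟨0, hd⟩⟩
  refine ⟨?_⟩
  rw [sphereUniform, Measure.smul_apply, Measure.map_apply measurable_subtype_coe .univ,
    Set.preimage_univ, smul_eq_mul]
  exact ENNReal.inv_mul_cancel 
    (by simpa using ⟨by omega, (Metric.measure_ball_pos volume _ one_pos).ne'⟩) (measure_ne_top _ _)

open scoped Pointwise in
theorem isInvariantOnUnitSphere_sphereUniform (d : ℕ) :
    IsInvariantOnUnitSphere (sphereUniform d) where
  ae_norm_eq_one := by
    refine Measure.ae_smul_measure ?_ _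
    rw [ae_map_iff measurable_subtype_coe.aemeasurable
      (measurableSet_eq_fun measurable_norm measurable_const)]
    exact Filter.Eventually.of_forall fun u => by simp
  measurePreserving A := by
    have hA : Measurable A := A.continuous.measurable
    refine ⟨hA, ?_⟩
    rw [sphereUniform, Measure.map_smul]
    congr 1
    ext s hs
    have hA' : MeasurePreserving A := (A.toLinearIsometryEquiv rfl).measurePreserving
    rw [Measure.map_apply hA hs, Measure.map_apply measurable_subtype_coe (hA hs),
      Measure.map_apply measurable_subtype_coe hs,
      Measure.toSphere_apply' _ (measurable_subtype_coe (hA hs)),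
      Measure.toSphere_apply' _ (measurable_subtype_coe hs), Subtype.image_preimage_coe,
      Subtype.image_preimage_coe]
    have hpre : Set.Ioo (0 : ℝ) 1 • (Metric.sphere (0 : EuclideanSpace ℝ (Fin d)) 1 ∩ A ⁻¹' s)
        = A ⁻¹' (Set.Ioo (0 : ℝ) 1 • (Metric.sphere 0 1 ∩ s)) := by
      ext u
      simp only [Set.mem_smul, Set.mem_preimage, Set.mem_inter_iff, mem_sphere_zero_iff_norm]
      constructor
      · rintro ⟨r, hr, z, ⟨hz, hzs⟩, rfl⟩
        exact ⟨r, hr, A z, ⟨by simpa using hz, hzs⟩, by simp⟩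
      · rintro ⟨r, hr, z, ⟨hz, hzs⟩, hu⟩
        obtain ⟨z, rfl⟩ := (A.toLinearIsometryEquiv rfl).surjective z
        refine ⟨r, hr, z, ⟨by simpa using hz, hzs⟩, A.injective ?_⟩
        rw [map_smul]
        exact hu
    rw [hpre, hA'.measure_preimage_emb
      (A.toLinearIsometryEquiv rfl).toHomeomorph.measurableEmbedding]

/-- The standard basis of `ℝ^d`, extended by zero to all natural indices. -/
noncomputable def stdVector (d i : ℕ) : EuclideanSpace ℝ (Fin d) :=
  if h : i < d then EuclideanSpace.single ⟨i, h⟩ 1 else 0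

theorem sum_inner_stdVector_smul (d : ℕ) (u : EuclideanSpace ℝ (Fin d)) :
    ∑ i ∈ Finset.range d, inner ℝ (stdVector d i) u • stdVector d i = u := by
  rw [Finset.sum_range]
  conv_rhs => rw [← (EuclideanSpace.basisFun (Fin d) ℝ).sum_repr' u]
  refine Finset.sum_congr rfl fun i _ => ?_
  simp [stdVector]

theorem inner_stdVector_of_ne (d : ℕ) {i j : ℕ} (hij : i ≠ j) :
    inner ℝ (stdVector d i) (stdVector d j) = 0 := by
  by_cases hi : i < d <;> by_cases hj : j < d <;>
    simp [stdVector, hi, hj, EuclideanSpace.inner_single_left, hij]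

section DirectionalDifference

variable {d : ℕ}

/-- The difference of the central difference quotients of `f` at `x` and `y`, as a function of the
direction. -/
noncomputable def centralDiffSub (f : EuclideanSpace ℝ (Fin d) → ℝ) (μ : ℝ)
    (x y u : EuclideanSpace ℝ (Fin d)) : ℝ :=
  (2 * μ)⁻¹ * ((f (x + μ • u) - f (x - μ • u)) - (f (y + μ • u) - f (y - μ • u)))

theorem hasGradientAt_centralDiffSub {f : EuclideanSpace ℝ (Fin d) → ℝ} (hf : Differentiable ℝ f)
    {μ : ℝ} (hμ : μ ≠ 0) (x y u : EuclideanSpace ℝ (Fin d)) :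
    HasGradientAt (centralDiffSub f μ x y)
      ((2⁻¹ : ℝ) • ((gradient f (x + μ • u) - gradient f (y + μ • u))
        + (gradient f (x - μ • u) - gradient f (y - μ • u)))) u := by
  have hg : ∀ z, HasFDerivAt f (InnerProductSpace.toDual ℝ _ (gradient f z)) z := fun z =>
    (hf z).hasGradientAt.hasFDerivAt
  have hid := (hasFDerivAt_id (𝕜 := ℝ) u).const_smul μ
  have hp : ∀ z : EuclideanSpace ℝ (Fin d), HasFDerivAt (fun w => f (z + μ • w)) _ u := fun z =>
    (hg (z + μ • u)).comp u (hid.const_add z)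
  have hm : ∀ z : EuclideanSpace ℝ (Fin d), HasFDerivAt (fun w => f (z - μ • w)) _ u := fun z =>
    (hg (z - μ • u)).comp u (hid.const_sub z)
  have h := (((hp x).sub (hm x)).sub ((hp y).sub (hm y))).const_mul (2 * μ)⁻¹
  refine h.congr_fderiv ?_
  ext w
  simp
  field_simp
  ring

theorem randGrad_sub_randGrad (f : EuclideanSpace ℝ (Fin d) → ℝ) (μ : ℝ)
    (x y u : EuclideanSpace ℝ (Fin d)) :
    randGrad d f μ x u - randGrad d f μ y u = ((d : ℝ) * centralDiffSub f μ x y u) • u := by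
  rw [randGrad, randGrad, centralDiffSub, ← sub_smul]
  congr 1
  ring

theorem centralDiffSub_neg (f : EuclideanSpace ℝ (Fin d) → ℝ) (μ : ℝ)
    (x y u : EuclideanSpace ℝ (Fin d)) :
    centralDiffSub f μ x y (-u) = -centralDiffSub f μ x y u := by
  simp only [centralDiffSub, smul_neg, sub_neg_eq_add, ← sub_eq_add_neg]
  ring

end DirectionalDifference

/-- If `f : ℝ^d → ℝ` (`d ≥ 1`) is `ℓ`-smooth, twice continuously differentiable and
`ρ`-Hessian Lipschitz, then for every `μ > 0` and all `x, y`,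
`E_u[‖∇̂_rand f(x) − ∇̂_rand f(y)‖²] ≤ 2 d ℓ² ‖x−y‖² + ρ² d² μ⁴/18`,
where the same direction `u`, uniform on the unit sphere, is used at both points. -/
theorem randGrad_difference_moment_bound (d : ℕ) (hd : 1 ≤ d)
    (f : EuclideanSpace ℝ (Fin d) → ℝ) (ℓ ρ : ℝ)
    (hf : ContDiff ℝ 2 f)
    (hGradLip : ∀ x y : EuclideanSpace ℝ (Fin d), ‖gradient f x - gradient f y‖ ≤ ℓ * ‖x - y‖)
    (hHessLip : ∀ x y : EuclideanSpace ℝ (Fin d),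
      ‖fderiv ℝ (gradient f) x - fderiv ℝ (gradient f) y‖ ≤ ρ * ‖x - y‖)
    (μ : ℝ) (hμ : 0 < μ) (x y : EuclideanSpace ℝ (Fin d)) :
    (∫ u, ‖randGrad d f μ x u - randGrad d f μ y u‖ ^ 2 ∂(sphereUniform d))
      ≤ 2 * d * ℓ ^ 2 * ‖x - y‖ ^ 2 + ρ ^ 2 * d ^ 2 * μ ^ 4 / 18 := by
  have := isProbabilityMeasure_sphereUniform hd
  have hσ := isInvariantOnUnitSphere_sphereUniform d
  have hdiff : Differentiable ℝ f := hf.differentiable (by norm_num)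
  have hgradc : Continuous (gradient f) :=
    (InnerProductSpace.toDual ℝ _).symm.continuous.comp (hf.continuous_fderiv (by norm_num))
  set L := ℓ * ‖x - y‖ with hL
  set G : EuclideanSpace ℝ (Fin d) → EuclideanSpace ℝ (Fin d) := fun u =>
    (2⁻¹ : ℝ) • ((gradient f (x + μ • u) - gradient f (y + μ • u))
      + (gradient f (x - μ • u) - gradient f (y - μ • u))) with hG
  have hGc : Continuous G := by fun_prop
  have hgrad : ∀ u, HasGradientAt (centralDiffSub f μ x y) (G u) u :=
    hasGradientAt_centralDiffSub hdiff hμ.ne' x y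
  have hGL : ∀ u, ‖G u‖ ≤ L := fun u => by
    have h1 := hGradLip (x + μ • u) (y + μ • u)
    have h2 := hGradLip (x - μ • u) (y - μ • u)
    rw [add_sub_add_right_eq_sub] at h1
    rw [sub_sub_sub_cancel_right] at h2
    have h3 := norm_add_le (gradient f (x + μ • u) - gradient f (y + μ • u))
      (gradient f (x - μ • u) - gradient f (y - μ • u))
    rw [hG, norm_smul, Real.norm_eq_abs, abs_of_pos (by norm_num)]
    linarith
  have hhc : Continuous (centralDiffSub f μ x y) :=
    continuous_iff_continuousAt.2 fun u => (hgrad u).continuousAt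
  have hL0 : 0 ≤ L := (norm_nonneg _).trans (hGL 0)
  have hpoincare := hσ.pred_mul_integral_sq_le (fun i j => inner_stdVector_of_ne d)
    (fun i hi => by simp [stdVector, hi]) (fun i hi => by simp [stdVector, hi.not_gt])
    (sum_inner_stdVector_smul d) (h := ⟨centralDiffSub f μ x y, hhc⟩)
    (centralDiffSub_neg f μ x y) hGc hgrad hGL
  simp only [ContinuousMap.coe_mk] at hpoincare
  have hsq : Continuous fun u => centralDiffSub f μ x y u ^ 2 := hhc.pow 2
  have htriv : ∫ u, centralDiffSub f μ x y u ^ 2 ∂(sphereUniform d) ≤ L ^ 2 := by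
    have : ∫ u, centralDiffSub f μ x y u ^ 2 ∂(sphereUniform d)
        ≤ ∫ _, L ^ 2 ∂(sphereUniform d) := by
      refine integral_mono_ae (hσ.integrable hsq) (integrable_const _) ?_
      filter_upwards [hσ.ae_norm_eq_one] with u hu
      have h := Convex.norm_image_sub_le_of_norm_hasFDerivWithin_le (s := Set.univ) (x := 0) (y := u)
        (fun z _ => (hgrad z).hasFDerivAt.hasFDerivWithinAt)
        (fun z _ => by simpa using hGL z) convex_univ trivial trivial
      have h0 : centralDiffSub f μ x y 0 = 0 := by simp [centralDiffSub]
      rw [h0, sub_zero, sub_zero, hu, mul_one, Real.norm_eq_abs] at h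
      exact sq_le_sq' (by linarith [abs_le.1 h]) (abs_le.1 h).2
    simpa using this
  have hint : ∫ u, ‖randGrad d f μ x u - randGrad d f μ y u‖ ^ 2 ∂(sphereUniform d)
      = d ^ 2 * ∫ u, centralDiffSub f μ x y u ^ 2 ∂(sphereUniform d) := by
    rw [← integral_const_mul]
    refine integral_congr_ae ?_
    filter_upwards [hσ.ae_norm_eq_one] with u hu
    rw [randGrad_sub_randGrad, norm_smul, hu, mul_one, Real.norm_eq_abs, sq_abs, mul_pow]
  rw [hint]
  set I := ∫ u, centralDiffSub f μ x y u ^ 2 ∂(sphereUniform d)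
  have hmain : (d : ℝ) * I ≤ 2 * L ^ 2 := by linarith
  have hρ : 0 ≤ ρ ^ 2 * d ^ 2 * μ ^ 4 / 18 := by positivity
  have hd0 : (0 : ℝ) ≤ d := by positivity
  calc (d : ℝ) ^ 2 * I = d * (d * I) := by ring
    _ ≤ d * (2 * L ^ 2) := by gcongr
    _ = 2 * d * ℓ ^ 2 * ‖x - y‖ ^ 2 := by rw [hL]; ring
    _ ≤ _ := by linarith
end

section
/- Let d ≥ 1, n ≥ 1, and let f = (1/n)·Σ_{i=1}^n f_i, where each f_i : ℝ^d → ℝ is ℓ-smooth, twice continuously differentiable and ρ-Hessian Lipschitz. Fix x ∈ ℝ^d, v ∈ ℝ^d with v ≠ 0, an integer m ≥ 1, and p ∈ (0, 1/2]. Let i_1,…,i_m be i.i.d. uniform on {1,…,n} and set z = (1/m)·Σ_{j=1}^m vᵀ𝓗_{f_{i_j}}(x)v, where each zeroth-order Hessian-vector product estimator uses smoothing parameter μ = ‖v‖. Then with probability at least 1 − p, |z/‖v‖² − vᵀ∇²f(x)v/‖v‖²| ≤ 2(ρ√d‖v‖ + ℓ)·√(log(1/p)/m) + ρ√d‖v‖.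 -/
open scoped RealInnerProductSpace Classical

variable {E : Type*} [NormedAddCommGroup E] [InnerProductSpace ℝ E] [CompleteSpace E]

theorem gradient_differentiable {f : E → ℝ} (hf : ContDiff ℝ 2 f) :
    Differentiable ℝ (gradient f) := by
  have h : ContDiff ℝ 1 (fderiv ℝ f) := hf.fderiv_right (by norm_num)
  exact ((InnerProductSpace.toDual ℝ E).symm.toContinuousLinearEquiv :
    StrongDual ℝ E ≃L[ℝ] E).differentiable.comp (h.differentiable (by norm_num))

theorem sum_exp_mul_sub_mean_le {ι : Type*} [Fintype ι] [Nonempty ι] (X : ι → ℝ) {B : ℝ}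
    (hB : ∀ i, |X i| ≤ B) (t : ℝ) :
    ∑ i, Real.exp (t * (X i - (∑ k, X k) / Fintype.card ι)) ≤
      Fintype.card ι * Real.exp (B ^ 2 * t ^ 2 / 2) := by
  let _ : MeasurableSpace ι := ⊤
  let P : MeasureTheory.Measure ι := (PMF.uniformOfFintype ι).toMeasure
  have hE : ∀ Y : ι → ℝ, ∫ i, Y i ∂P = (∑ k, Y k) / Fintype.card ι := fun Y => by
    simp [P, PMF.integral_eq_sum, Finset.mul_sum, div_eq_inv_mul]
  have hsub := (ProbabilityTheory.hasSubgaussianMGF_of_mem_Icc (μ := P) (X := X)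
    (a := -B) (b := B) (measurable_of_countable X).aemeasurable
    (Filter.Eventually.of_forall fun i => abs_le.mp (hB i))).mgf_le t
  rw [ProbabilityTheory.mgf, hE, hE, div_le_iff₀ (by positivity)] at hsub
  have hB0 : 0 ≤ B := (abs_nonneg _).trans (hB (Classical.arbitrary ι))
  have hc : ((((‖B - -B‖₊ / 2) ^ 2 : NNReal)) : ℝ) = B ^ 2 := by
    simp only [NNReal.coe_pow, NNReal.coe_div, coe_nnnorm, Real.norm_eq_abs, NNReal.coe_ofNat]
    rw [abs_of_nonneg (by linarith)]
    ring
  rw [hc] at hsub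
  linarith

theorem card_lt_sum_sub_mean_le {ι : Type*} [Fintype ι] [Nonempty ι] (X : ι → ℝ) {B : ℝ}
    (hB : ∀ i, |X i| ≤ B) (m : ℕ) (t s : ℝ) (ht : 0 ≤ t) :
    ((Finset.univ.filter fun ω : Fin m → ι =>
        s < ∑ j, (X (ω j) - (∑ k, X k) / Fintype.card ι)).card : ℝ) ≤
      (Fintype.card ι : ℝ) ^ m * Real.exp (m * (B ^ 2 * t ^ 2 / 2) - t * s) := by
  set Y : ι → ℝ := fun i => X i - (∑ k, X k) / Fintype.card ι with hY
  have hmgf : ∑ ω : Fin m → ι, Real.exp (t * ∑ j, Y (ω j)) =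
      (∑ i, Real.exp (t * Y i)) ^ m := by
    rw [Fintype.sum_pow]
    exact Finset.sum_congr rfl fun ω _ => by rw [Finset.mul_sum, Real.exp_sum]
  have hmarkov : ((Finset.univ.filter fun ω : Fin m → ι => s < ∑ j, Y (ω j)).card : ℝ) *
      Real.exp (t * s) ≤ ∑ ω : Fin m → ι, Real.exp (t * ∑ j, Y (ω j)) := by
    rw [← nsmul_eq_mul]
    refine (Finset.card_nsmul_le_sum _ _ _ fun ω hω => ?_).trans
      (Finset.sum_le_sum_of_subset_of_nonneg (Finset.filter_subset _ _)
        fun _ _ _ => (Real.exp_pos _).le)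
    exact Real.exp_le_exp.mpr (mul_le_mul_of_nonneg_left (Finset.mem_filter.mp hω).2.le ht)
  rw [Real.exp_sub, Real.exp_nat_mul, ← mul_div_assoc, ← mul_pow, le_div_iff₀ (Real.exp_pos _)]
  refine hmarkov.trans (hmgf.trans_le ?_)
  gcongr
  exact sum_exp_mul_sub_mean_le X hB t

theorem norm_le_of_norm_deriv_le_affine {F : Type*} [NormedAddCommGroup F] [NormedSpace ℝ F]
    {g g' : ℝ → F} {a b : ℝ} (h0 : g 0 = 0) (hg : ∀ t, HasDerivAt g (g' t) t)
    (bound : ∀ t ∈ Set.Ico (0 : ℝ) 1, ‖g' t‖ ≤ a + b * t) : ‖g 1‖ ≤ a + b / 2 := by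
  have hB : ∀ t : ℝ, HasDerivAt (fun t => a * t + b / 2 * t ^ 2) (a + b * t) t := fun t => by
    refine (((hasDerivAt_id t).const_mul a).add
      ((hasDerivAt_pow 2 t).const_mul (b / 2))).congr_deriv ?_
    norm_num
    ring
  have := image_norm_le_of_norm_deriv_right_le_deriv_boundary (a := 0) (b := 1)
    (fun t _ => (hg t).continuousAt.continuousWithinAt)
    (fun t _ => (hg t).hasDerivWithinAt) (by simp [h0]) hB bound
    (Set.right_mem_Icc.mpr zero_le_one)
  simpa using this

theorem norm_gradient_add_sub_sub_le {f : E → ℝ} {ρ : ℝ} (hf : ContDiff ℝ 2 f) (hρ : 0 ≤ ρ)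
    (hHess : ∀ x y, ‖fderiv ℝ (gradient f) x - fderiv ℝ (gradient f) y‖ ≤ ρ * ‖x - y‖)
    (x w v : E) :
    ‖gradient f (x + w + v) - gradient f (x + w) - fderiv ℝ (gradient f) x v‖ ≤
      ρ * ‖w‖ * ‖v‖ + ρ * ‖v‖ * ‖v‖ / 2 := by
  have hd := gradient_differentiable hf
  have key := norm_le_of_norm_deriv_le_affine (a := ρ * ‖w‖ * ‖v‖) (b := ρ * ‖v‖ * ‖v‖)
    (g := fun s : ℝ => gradient f (x + w + s • v) - gradient f (x + w)
      - s • fderiv ℝ (gradient f) x v)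
    (g' := fun s => fderiv ℝ (gradient f) (x + w + s • v) v - fderiv ℝ (gradient f) x v)
    (by simp) (fun s => by
      have h1 : HasDerivAt (fun s : ℝ => x + w + s • v) v s := by
        simpa using ((hasDerivAt_id s).smul_const v).const_add (x + w)
      have h2 := (hd (x + w + s • v)).hasFDerivAt.comp_hasDerivAt s h1
      have h3 := (hasDerivAt_id s).smul_const (fderiv ℝ (gradient f) x v)
      exact ((h2.sub_const (gradient f (x + w))).sub h3).congr_deriv (by rw [one_smul]))
    (fun s hs => by
      rw [← sub_apply]
      refine (ContinuousLinearMap.le_opNorm _ _).trans ?_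
      have h1 : ‖x + w + s • v - x‖ ≤ ‖w‖ + s * ‖v‖ := by
        rw [show x + w + s • v - x = w + s • v by abel]
        refine (norm_add_le _ _).trans_eq ?_
        rw [norm_smul, Real.norm_of_nonneg hs.1]
      calc _ ≤ ρ * (‖w‖ + s * ‖v‖) * ‖v‖ := by
            gcongr
            exact (hHess _ _).trans (by gcongr)
        _ = _ := by ring)
  simpa using key

theorem hasDerivAt_comp_add_smul {f : E → ℝ} (hf : Differentiable ℝ f) (y e : E) (t : ℝ) :
    HasDerivAt (fun t : ℝ => f (y + t • e)) ⟪gradient f (y + t • e), e⟫ t := by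
  have h1 : HasDerivAt (fun t : ℝ => y + t • e) e t := by
    simpa using ((hasDerivAt_id t).smul_const e).const_add y
  have h2 := (hf (y + t • e)).hasFDerivAt.comp_hasDerivAt t h1
  rwa [← inner_gradient_left] at h2

theorem abs_second_difference_sub_le {f : E → ℝ} {ρ : ℝ} (hf : ContDiff ℝ 2 f) (hρ : 0 ≤ ρ)
    (hHess : ∀ x y, ‖fderiv ℝ (gradient f) x - fderiv ℝ (gradient f) y‖ ≤ ρ * ‖x - y‖)
    (x v e : E) :
    |f (x + v + e) - f (x + v - e) + f (x - e) - f (x + e)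
        - 2 * ⟪fderiv ℝ (gradient f) x v, e⟫| ≤ ρ * ‖v‖ * ‖e‖ * (‖v‖ + ‖e‖) := by
  have hd : Differentiable ℝ f := hf.differentiable (by norm_num)
  set H := fderiv ℝ (gradient f) x v with hH
  have key := norm_le_of_norm_deriv_le_affine (a := ρ * ‖v‖ * ‖v‖ * ‖e‖)
    (b := 2 * (ρ * ‖v‖ * ‖e‖ * ‖e‖))
    (g := fun t : ℝ => f (x + v + t • e) - f (x + v + t • (-e)) + f (x + t • (-e))
      - f (x + t • e) - t * (2 * ⟪H, e⟫))
    (g' := fun t => ⟪gradient f (x + t • e + v) - gradient f (x + t • e) - H, e⟫ +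
      ⟪gradient f (x + t • (-e) + v) - gradient f (x + t • (-e)) - H, e⟫)
    (by simp) (fun t => by
      refine (((((hasDerivAt_comp_add_smul hd (x + v) e t).sub
        (hasDerivAt_comp_add_smul hd (x + v) (-e) t)).add
        (hasDerivAt_comp_add_smul hd x (-e) t)).sub
        (hasDerivAt_comp_add_smul hd x e t)).sub
        ((hasDerivAt_id t).mul_const (2 * ⟪H, e⟫))).congr_deriv ?_
      simp only [inner_sub_left, inner_neg_right, add_right_comm x v]
      ring)
    (fun t ht => by
      have h1 : ∀ u : E, ‖u‖ = ‖e‖ →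
          ‖⟪gradient f (x + t • u + v) - gradient f (x + t • u) - H, e⟫‖ ≤
          (ρ * (t * ‖e‖) * ‖v‖ + ρ * ‖v‖ * ‖v‖ / 2) * ‖e‖ := fun u hu => by
        refine (norm_inner_le_norm _ _).trans ?_
        gcongr
        refine (norm_gradient_add_sub_sub_le hf hρ hHess x (t • u) v).trans_eq ?_
        rw [norm_smul, hu, Real.norm_of_nonneg ht.1]
      refine (norm_add_le _ _).trans ((add_le_add (h1 e rfl) (h1 (-e) (norm_neg e))).trans_eq ?_)
      ring)
  simp only [one_smul, one_mul, ← sub_eq_add_neg, Real.norm_eq_abs] at key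
  refine key.trans_eq ?_
  ring

theorem norm_zoHvp_sub_le {d : ℕ} {f : EuclideanSpace ℝ (Fin d) → ℝ} {ρ : ℝ}
    (hf : ContDiff ℝ 2 f) (hρ : 0 ≤ ρ)
    (hHess : ∀ x y, ‖fderiv ℝ (gradient f) x - fderiv ℝ (gradient f) y‖ ≤ ρ * ‖x - y‖)
    (x v : EuclideanSpace ℝ (Fin d)) (hv : v ≠ 0) :
    ‖zoHvp d f ‖v‖ x v - fderiv ℝ (gradient f) x v‖ ≤ ρ * √d * ‖v‖ ^ 2 := by
  have hv0 : 0 < ‖v‖ := norm_pos_iff.mpr hv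
  have hcoord : ∀ i, |(zoHvp d f ‖v‖ x v - fderiv ℝ (gradient f) x v) i| ≤ ρ * ‖v‖ ^ 2 := by
    intro i
    have h := abs_second_difference_sub_le hf hρ hHess x v (‖v‖ • EuclideanSpace.single i 1)
    have hz : zoHvp d f ‖v‖ x v i =
        (f (x + v + ‖v‖ • EuclideanSpace.single i 1) - f (x + v - ‖v‖ • EuclideanSpace.single i 1)
        + f (x - ‖v‖ • EuclideanSpace.single i 1) - f (x + ‖v‖ • EuclideanSpace.single i 1))
          / (2 * ‖v‖) := by
      simp [zoHvp, Pi.single_apply]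
    rw [inner_smul_right, EuclideanSpace.inner_single_right, norm_smul] at h
    simp only [norm_norm, PiLp.norm_single, norm_one, mul_one, one_mul,
      conj_trivial] at h
    have h2 : 0 < 2 * ‖v‖ := by positivity
    rw [PiLp.sub_apply, hz, div_sub' h2.ne', abs_div, abs_of_pos h2, div_le_iff₀ h2, mul_assoc 2]
    exact h.trans_eq (by ring)
  rw [EuclideanSpace.norm_eq, ← Real.sqrt_sq (by positivity : 0 ≤ ρ * √d * ‖v‖ ^ 2)]
  refine Real.sqrt_le_sqrt
    ((Finset.sum_le_card_nsmul _ _ ((ρ * ‖v‖ ^ 2) ^ 2) fun i _ => ?_).trans_eq ?_)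
  · rw [Real.norm_eq_abs]
    gcongr
    exact hcoord i
  · rw [mul_right_comm ρ, mul_pow _ (√d), Real.sq_sqrt (Nat.cast_nonneg d)]
    simp [mul_comm]

theorem card_lt_sum_sub_mean_le_sq {ι : Type*} [Fintype ι] [Nonempty ι] (X : ι → ℝ) {B : ℝ}
    (hB : ∀ i, |X i| ≤ B) {m : ℕ} (hm : 1 ≤ m) {p : ℝ} (hp0 : 0 < p) (hp1 : p ≤ 1) :
    ((Finset.univ.filter fun ω : Fin m → ι =>
        m * (2 * B * √(Real.log (1 / p) / m)) <
          ∑ j, (X (ω j) - (∑ k, X k) / Fintype.card ι)).card : ℝ) ≤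
      (Fintype.card ι : ℝ) ^ m * p ^ 2 := by
  have hm0 : (0 : ℝ) < m := by exact_mod_cast hm
  have hL : 0 ≤ Real.log (1 / p) := Real.log_nonneg (by rwa [le_div_iff₀ hp0, one_mul])
  set r := √(Real.log (1 / p) / m) with hr
  have hr2 : m * r ^ 2 = - Real.log p := by
    rw [hr, Real.sq_sqrt (by positivity), mul_div_cancel₀ _ hm0.ne', one_div, Real.log_inv]
  rcases ((abs_nonneg _).trans (hB (Classical.arbitrary ι))).eq_or_lt with rfl | hB0
  · have hX : ∀ i, X i = 0 := fun i => abs_nonpos_iff.mp (hB i)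
    simp only [hX, mul_zero, zero_mul, Finset.sum_const_zero, zero_div, sub_zero, lt_irrefl,
      Finset.filter_false, Finset.card_empty, Nat.cast_zero]
    positivity
  · refine (card_lt_sum_sub_mean_le X hB m (2 * r / B) _ (by positivity)).trans_eq ?_
    have hexp : m * (B ^ 2 * (2 * r / B) ^ 2 / 2) - 2 * r / B * (m * (2 * B * r)) =
        (2 : ℕ) * Real.log p := by
      field_simp
      push_cast
      linear_combination (-2) * hr2
    rw [hexp, Real.exp_nat_mul, Real.exp_log hp0]

theorem le_card_abs_average_sub_mean_le {ι : Type*} [Fintype ι] [Nonempty ι] (X : ι → ℝ) {B : ℝ}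
    (hB : ∀ i, |X i| ≤ B) {m : ℕ} (hm : 1 ≤ m) {p : ℝ} (hp0 : 0 < p) (hp : p ≤ 1 / 2) :
    (1 - p) * (Fintype.card ι : ℝ) ^ m ≤
      ((Finset.univ.filter fun ω : Fin m → ι =>
        |(∑ j, X (ω j)) / m - (∑ k, X k) / Fintype.card ι| ≤
          2 * B * √(Real.log (1 / p) / m)).card : ℝ) := by
  have hm0 : (0 : ℝ) < m := by exact_mod_cast hm
  have hupper := card_lt_sum_sub_mean_le_sq X hB hm hp0 (by linarith)
  have hlower := card_lt_sum_sub_mean_le_sq (fun i => -X i) (by simpa using hB) hm hp0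
    (by linarith)
  set A := (∑ k, X k) / Fintype.card ι with hA
  set R := 2 * B * √(Real.log (1 / p) / m) with hR
  have hneg : (∑ k, -X k) / Fintype.card ι = -A := by rw [Finset.sum_neg_distrib, neg_div]
  rw [hneg] at hlower
  have hcover : (Finset.univ : Finset (Fin m → ι)) ⊆
      (Finset.univ.filter fun ω : Fin m → ι => |(∑ j, X (ω j)) / m - A| ≤ R) ∪
      ((Finset.univ.filter fun ω : Fin m → ι => m * R < ∑ j, (X (ω j) - A)) ∪
       (Finset.univ.filter fun ω : Fin m → ι => m * R < ∑ j, (-X (ω j) - -A))) := by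
    intro ω _
    simp only [Finset.mem_union, Finset.mem_filter, Finset.mem_univ, true_and]
    by_contra! h
    obtain ⟨h1, h2, h3⟩ := h
    simp only [Finset.sum_sub_distrib, Finset.sum_neg_distrib, Finset.sum_const,
      Finset.card_univ, Fintype.card_fin, nsmul_eq_mul] at h2 h3
    refine h1.not_ge (abs_le.mpr ⟨?_, ?_⟩)
    · rw [le_sub_iff_add_le, le_div_iff₀ hm0]
      linarith
    · rw [sub_le_iff_le_add, div_le_iff₀ hm0]
      linarith
  have hcard := (Finset.card_le_card hcover).trans ((Finset.card_union_le _ _).trans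
    (Nat.add_le_add_left (Finset.card_union_le _ _) _))
  rw [Finset.card_univ, Fintype.card_fun, Fintype.card_fin] at hcard
  have hcard' := (Nat.cast_le (α := ℝ)).mpr hcard
  push_cast at hcard'
  have hpp : (Fintype.card ι : ℝ) ^ m * (2 * p ^ 2) ≤ (Fintype.card ι : ℝ) ^ m * p := by
    gcongr
    nlinarith
  linarith

theorem fderiv_gradient_sum_div {ι : Type*} [Fintype ι] {fs : ι → E → ℝ}
    (hf : ∀ i, ContDiff ℝ 2 (fs i)) (c : ℝ) (x v : E) :
    fderiv ℝ (gradient fun y => (∑ i, fs i y) / c) x v =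
      c⁻¹ • ∑ i, fderiv ℝ (gradient (fs i)) x v := by
  have hgrad : (gradient fun y => (∑ i, fs i y) / c) =
      fun y => c⁻¹ • ∑ i, gradient (fs i) y := by
    refine gradient_eq fun y => ?_
    have h := (HasFDerivAt.fun_sum (u := Finset.univ) fun i _ =>
      ((hf i).differentiable (by norm_num) y).hasFDerivAt).const_mul c⁻¹
    rw [hasGradientAt_iff_hasFDerivAt]
    refine (h.congr_fderiv ?_).congr_of_eventuallyEq
      (Filter.Eventually.of_forall fun z => div_eq_inv_mul _ _)
    ext w
    simp
  rw [hgrad]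
  have h := (HasFDerivAt.fun_sum (u := Finset.univ) fun i _ =>
    (gradient_differentiable (hf i) x).hasFDerivAt).const_smul c⁻¹
  refine (DFunLike.congr_fun h.fderiv v).trans ?_
  simp

/-- Concentration of the averaged zeroth-order Hessian quadratic form: with
`f = (1/n)Σᵢ fᵢ`, each `fᵢ` `ℓ`-smooth, C² and `ρ`-Hessian Lipschitz, `v ≠ 0`,
`μ = ‖v‖` in each estimator, `m ≥ 1` samples `i₁,…,i_m` i.i.d. uniform on `{1,…,n}`
(modelled as a uniformly random tuple `ω : Fin m → Fin n`), and `p ∈ (0, 1/2]`,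
with probability at least `1 − p` (i.e. for at least `(1−p)·nᵐ` of the `nᵐ` tuples),
`|z/‖v‖² − vᵀ∇²f(x)v/‖v‖²| ≤ 2(ρ√d‖v‖ + ℓ)√(log(1/p)/m) + ρ√d‖v‖`, where
`z = (1/m)Σⱼ vᵀ𝓗_{f_{iⱼ}}(x)v`. -/
theorem zoHvp_average_concentration (d n m : ℕ) (hd : 1 ≤ d) (hn : 1 ≤ n) (hm : 1 ≤ m)
    (fs : Fin n → EuclideanSpace ℝ (Fin d) → ℝ) (ℓ ρ : ℝ)
    (hf : ∀ i, ContDiff ℝ 2 (fs i))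
    (hGradLip : ∀ i, ∀ x y : EuclideanSpace ℝ (Fin d),
      ‖gradient (fs i) x - gradient (fs i) y‖ ≤ ℓ * ‖x - y‖)
    (hHessLip : ∀ i, ∀ x y : EuclideanSpace ℝ (Fin d),
      ‖fderiv ℝ (gradient (fs i)) x - fderiv ℝ (gradient (fs i)) y‖ ≤ ρ * ‖x - y‖)
    (x v : EuclideanSpace ℝ (Fin d)) (hv : v ≠ 0)
    (p : ℝ) (hp0 : 0 < p) (hp : p ≤ 1 / 2)
    (f : EuclideanSpace ℝ (Fin d) → ℝ) (hfdef : f = fun y => (∑ i, fs i y) / n) :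
    (1 - p) * (n : ℝ) ^ m ≤
      ((Finset.univ.filter fun ω : Fin m → Fin n =>
        |(∑ j, ⟪v, zoHvp d (fs (ω j)) ‖v‖ x v⟫) / m / ‖v‖ ^ 2
            - ⟪v, fderiv ℝ (gradient f) x v⟫ / ‖v‖ ^ 2|
          ≤ 2 * (ρ * Real.sqrt d * ‖v‖ + ℓ) * Real.sqrt (Real.log (1 / p) / m)
              + ρ * Real.sqrt d * ‖v‖).card : ℝ) := by
  have hv0 : 0 < ‖v‖ := norm_pos_iff.mpr hv
  have hne : Nonempty (Fin n) := ⟨⟨0, hn⟩⟩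
  have hn0 : (0 : ℝ) < n := by exact_mod_cast hn
  have hρ : 0 ≤ ρ := by
    have h := (norm_nonneg _).trans (hHessLip ⟨0, hn⟩ v 0)
    rw [sub_zero] at h
    exact nonneg_of_mul_nonneg_left h hv0
  have hℓ : 0 ≤ ℓ := by
    have h := (norm_nonneg _).trans (hGradLip ⟨0, hn⟩ v 0)
    rw [sub_zero] at h
    exact nonneg_of_mul_nonneg_left h hv0
  set X : Fin n → ℝ := fun i => ⟪v, zoHvp d (fs i) ‖v‖ x v⟫ / ‖v‖ ^ 2 with hX
  set h : Fin n → ℝ := fun i => ⟪v, fderiv ℝ (gradient (fs i)) x v⟫ / ‖v‖ ^ 2 with hh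
  have hbias : ∀ i, |X i - h i| ≤ ρ * √d * ‖v‖ := fun i => by
    rw [hX, hh, ← sub_div, ← inner_sub_right, abs_div, abs_of_pos (by positivity : 0 < ‖v‖ ^ 2),
      div_le_iff₀ (by positivity)]
    calc _ ≤ ‖v‖ * ‖zoHvp d (fs i) ‖v‖ x v - fderiv ℝ (gradient (fs i)) x v‖ :=
          abs_real_inner_le_norm _ _
      _ ≤ ‖v‖ * (ρ * √d * ‖v‖ ^ 2) := by
          gcongr
          exact norm_zoHvp_sub_le (hf i) hρ (hHessLip i) x v hv
      _ = _ := by ring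
  have hhess : ∀ i, |h i| ≤ ℓ := fun i => by
    have hop : ‖fderiv ℝ (gradient (fs i)) x‖ ≤ ℓ :=
      norm_fderiv_le_of_lip' ℝ hℓ (Filter.Eventually.of_forall fun y => hGradLip i y x)
    rw [hh, abs_div, abs_of_pos (by positivity : 0 < ‖v‖ ^ 2), div_le_iff₀ (by positivity)]
    calc _ ≤ ‖v‖ * ‖fderiv ℝ (gradient (fs i)) x v‖ := abs_real_inner_le_norm _ _
      _ ≤ ‖v‖ * (ℓ * ‖v‖) := by
          gcongr
          exact ContinuousLinearMap.le_of_opNorm_le _ hop v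
      _ = _ := by ring
  have hXB : ∀ i, |X i| ≤ ρ * √d * ‖v‖ + ℓ := fun i => by
    have := abs_add_le (X i - h i) (h i)
    rw [sub_add_cancel] at this
    linarith [hbias i, hhess i]
  have hmean : ⟪v, fderiv ℝ (gradient f) x v⟫ / ‖v‖ ^ 2 = (∑ i, h i) / n := by
    rw [hfdef, fderiv_gradient_sum_div hf, inner_smul_right, inner_sum, hh, ← Finset.sum_div]
    ring
  have hmeanbias : |(∑ i, X i) / n - (∑ i, h i) / n| ≤ ρ * √d * ‖v‖ := by
    rw [← sub_div, ← Finset.sum_sub_distrib, abs_div, abs_of_pos hn0, div_le_iff₀ hn0]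
    refine (Finset.abs_sum_le_sum_abs _ _).trans
      ((Finset.sum_le_card_nsmul _ _ _ fun i _ => hbias i).trans_eq ?_)
    simp [mul_comm]
  have hconc := le_card_abs_average_sub_mean_le X hXB hm hp0 hp
  rw [Fintype.card_fin] at hconc
  refine hconc.trans (Nat.cast_le.mpr (Finset.card_le_card fun ω hω => ?_))
  simp only [Finset.mem_filter, Finset.mem_univ, true_and] at hω ⊢
  rw [hmean, div_right_comm, Finset.sum_div]
  exact (abs_sub_le _ _ _).trans (add_le_add hω hmeanbias)
end

section
/- Let f : ℝ^d → ℝ be ℓ-smooth with ℓ > 0, let n₀ ≥ 1 and 0 < ε ≤ ε̃. Suppose v ∈ ℝ^d satisfies ‖v‖ ≥ 2ε̃ and ‖v − ∇f(x)‖² ≤ ε·ε̃ at some point x ∈ ℝ^d. Then the normalized step x' = x − (ε/(ℓ·n₀·‖v‖))·v satisfies f(x') ≤ f(x) − ε·ε̃/(4·ℓ·n₀). -/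
/-- The descent lemma: a function with `ℓ`-Lipschitz gradient lies below its quadratic upper
model at every point. -/
theorem le_add_inner_gradient_add_sq {E : Type*} [NormedAddCommGroup E] [InnerProductSpace ℝ E]
    [CompleteSpace E] {f : E → ℝ} {ℓ : ℝ} (hf : Differentiable ℝ f)
    (hlip : ∀ x y, ‖gradient f x - gradient f y‖ ≤ ℓ * ‖x - y‖) (x w : E) :
    f (x + w) ≤ f x + inner ℝ (gradient f x) w + ℓ / 2 * ‖w‖ ^ 2 := by
  let φ : ℝ → ℝ := fun t =>
    f (x + t • w) - t * inner ℝ (gradient f x) w - t ^ 2 * (ℓ / 2 * ‖w‖ ^ 2)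
  have hφ (t : ℝ) : HasDerivAt φ (inner ℝ (gradient f (x + t • w)) w
      - inner ℝ (gradient f x) w - 2 * t * (ℓ / 2 * ‖w‖ ^ 2)) t := by
    have hline : HasDerivAt (fun s : ℝ => x + s • w) w t := by
      simpa using ((hasDerivAt_id t).smul_const w).const_add x
    have hcomp := (hf (x + t • w)).hasGradientAt.hasFDerivAt.comp_hasDerivAt t hline
    have hlin := (hasDerivAt_id t).mul_const (inner ℝ (gradient f x) w)
    have hsq := (hasDerivAt_pow 2 t).mul_const (ℓ / 2 * ‖w‖ ^ 2)
    exact ((hcomp.sub hlin).sub hsq).congr_deriv (by simp)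
  have hanti : AntitoneOn φ (Set.Icc 0 1) := by
    refine antitoneOn_of_deriv_nonpos (convex_Icc 0 1)
      (fun t _ => (hφ t).continuousAt.continuousWithinAt)
      (fun t _ => (hφ t).differentiableAt.differentiableWithinAt) fun t ht => ?_
    rw [interior_Icc] at ht
    have hgrad : ‖gradient f (x + t • w) - gradient f x‖ ≤ ℓ * (t * ‖w‖) := by
      simpa [norm_smul, abs_of_pos ht.1] using hlip (x + t • w) x
    have hinner := real_inner_le_norm (gradient f (x + t • w) - gradient f x) w
    rw [inner_sub_left] at hinner
    have hmul := mul_le_mul_of_nonneg_right hgrad (norm_nonneg w)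
    rw [(hφ t).deriv]
    linarith
  have h01 := hanti (Set.left_mem_Icc.2 zero_le_one) (Set.right_mem_Icc.2 zero_le_one) zero_le_one
  simp only [φ, one_smul, zero_smul, add_zero] at h01
  linarith

/-- Per-iteration descent of the normalized SPIDER step: if `f : ℝ^d → ℝ` is `ℓ`-smooth
(`ℓ > 0`), `n₀ ≥ 1`, `0 < ε ≤ ε̃`, and `v` satisfies `‖v‖ ≥ 2ε̃` and `‖v − ∇f(x)‖² ≤ εε̃`,
then `x' = x − (ε/(ℓn₀‖v‖))·v` satisfies `f(x') ≤ f(x) − εε̃/(4ℓn₀)`. -/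
theorem normalized_spider_descent (d : ℕ) (f : EuclideanSpace ℝ (Fin d) → ℝ) (ℓ : ℝ)
    (hℓ : 0 < ℓ)
    (hdiff : Differentiable ℝ f)
    (hGradLip : ∀ x y : EuclideanSpace ℝ (Fin d), ‖gradient f x - gradient f y‖ ≤ ℓ * ‖x - y‖)
    (n₀ : ℝ) (hn₀ : 1 ≤ n₀) (ε εt : ℝ) (hε : 0 < ε) (hεεt : ε ≤ εt)
    (x v : EuclideanSpace ℝ (Fin d)) (hv : 2 * εt ≤ ‖v‖)
    (hacc : ‖v - gradient f x‖ ^ 2 ≤ ε * εt) :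
    f (x - (ε / (ℓ * n₀ * ‖v‖)) • v) ≤ f x - ε * εt / (4 * ℓ * n₀) := by
  have hεt : 0 < εt := hε.trans_le hεεt
  have hv0 : 0 < ‖v‖ := by linarith
  have hn : 0 < n₀ := by linarith
  have herr : ‖v - gradient f x‖ ≤ εt := by
    refine (sq_le_sq₀ (norm_nonneg _) hεt.le).1 ?_
    nlinarith
  set s := ε / (ℓ * n₀) with hs
  have hs0 : 0 < s := by positivity
  have hℓs : ℓ * s ≤ ε := by
    rw [hs, show ℓ * (ε / (ℓ * n₀)) = ε / n₀ by field_simp]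
    exact div_le_self hε.le hn₀
  have hstep : ε / (ℓ * n₀ * ‖v‖) = s / ‖v‖ := by rw [hs, div_div]
  have hgain : ε * εt / (4 * ℓ * n₀) = s * εt / 4 := by rw [hs]; field_simp
  have hinner : ‖v‖ * (‖v‖ - εt) ≤ inner ℝ (gradient f x) v := by
    have hcs := real_inner_le_norm (v - gradient f x) v
    rw [inner_sub_left, real_inner_self_eq_norm_sq] at hcs
    nlinarith
  have hnorm : ‖-((s / ‖v‖) • v)‖ = s := by
    rw [norm_neg, norm_smul, Real.norm_of_nonneg (by positivity), div_mul_cancel₀ _ hv0.ne']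
  have hdesc := le_add_inner_gradient_add_sq hdiff hGradLip x (-((s / ‖v‖) • v))
  rw [hnorm, inner_neg_right, real_inner_smul_right, ← sub_eq_add_neg] at hdesc
  have hlinear : s * (‖v‖ - εt) ≤ s / ‖v‖ * inner ℝ (gradient f x) v := by
    calc s * (‖v‖ - εt) = s / ‖v‖ * (‖v‖ * (‖v‖ - εt)) := by field_simp
      _ ≤ _ := by gcongr
  rw [hstep, hgain]
  nlinarith [mul_le_mul_of_nonneg_left hℓs hs0.le, mul_le_mul_of_nonneg_left hεεt hs0.le,
    mul_le_mul_of_nonneg_left hv hs0.le, mul_pos hs0 hεt]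
end
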